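/- arXiv:1907.05063 — 3 statements merged into one kernel-verified Lean document; each statement's English description precedes it below -/
import Mathlib

section
/- For every n ≥ 7, the finite group A_n^{2^n}, the direct product of 2^n copies of the alternating group A_n on n letters, is generated by 2 elements. -/
section

open Equiv Equiv.Perm

theorem Subgroup.eq_top_of_pairwise_separating {ι S : Type*} [Finite ι] [Group S] [IsSimpleGroup S]
    (hcenter : Subgroup.center S = ⊥) (H : Subgroup (ι → S)) (surj : ∀ i s, ∃ x ∈ H, x i = s)
    (sep : ∀ i j, i ≠ j → ∃ x ∈ H, x i = 1 ∧ x j ≠ 1) : H = ⊤ := by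
  classical
  have normal_image : ∀ (K : Subgroup (ι → S)), K.Normal → ∀ j, (∃ x ∈ H ⊓ K, x j ≠ 1) →
      ∀ s, ∃ x ∈ H ⊓ K, x j = s := by
    rintro K hK j ⟨x, hx, hxj⟩ s
    have hN : ((H ⊓ K).map (Pi.evalMonoidHom (fun _ => S) j)).Normal := by
      constructor
      rintro _ ⟨y, hy, rfl⟩ t
      obtain ⟨z, hz, rfl⟩ := surj j t
      exact ⟨z * y * z⁻¹, ⟨H.mul_mem (H.mul_mem hz hy.1) (H.inv_mem hz), hK.conj_mem _ hy.2 _⟩,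
        by simp⟩
    have htop := hN.eq_bot_or_eq_top.resolve_left fun h =>
      hxj (by simpa using (h ▸ (⟨x, hx, rfl⟩ : x j ∈ (H ⊓ K).map (Pi.evalMonoidHom (fun _ => S) j)) :
        x j ∈ (⊥ : Subgroup S)))
    obtain ⟨y, hy, rfl⟩ := (htop ▸ Subgroup.mem_top s :
      s ∈ (H ⊓ K).map (Pi.evalMonoidHom (fun _ => S) j))
    exact ⟨y, hy, rfl⟩
  have hker : ∀ (A : Set ι), ∃ K : Subgroup (ι → S), K.Normal ∧ ∀ x, x ∈ K ↔ ∀ i ∈ A, x i = 1 := by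
    intro A
    refine ⟨⨅ i ∈ A, (Pi.evalMonoidHom (fun _ : ι => S) i).ker, ?_, by
      simp [Subgroup.mem_iInf, MonoidHom.mem_ker]⟩
    exact Subgroup.normal_iInf_normal fun i => Subgroup.normal_iInf_normal fun _ => inferInstance
  have step : ∀ j (A : Finset ι), j ∉ A → ∃ x ∈ H, (∀ i ∈ A, x i = 1) ∧ x j ≠ 1 := by
    intro j A
    induction A using Finset.induction_on with
    | empty =>
      intro _
      obtain ⟨a, ha⟩ := exists_ne (1 : S)
      obtain ⟨x, hx, rfl⟩ := surj j a
      exact ⟨x, hx, by simp, ha⟩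
    | insert i A _ ih =>
      intro hj
      rw [Finset.mem_insert, not_or] at hj
      obtain ⟨x, hx, hxA, hxj⟩ := ih hj.2
      obtain ⟨y, hy, hyi, hyj⟩ := sep i j (Ne.symm hj.1)
      obtain ⟨K, hK, hKm⟩ := hker {i}
      have hxc : x j ∉ Subgroup.center S := by simpa [hcenter] using hxj
      rw [Subgroup.mem_center_iff] at hxc
      push Not at hxc
      obtain ⟨s, hs⟩ := hxc
      obtain ⟨z, hz, rfl⟩ := normal_image K hK j ⟨y, ⟨hy, (hKm y).2 (by simpa using hyi)⟩, hyj⟩ s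
      have hzi : z i = 1 := (hKm z).1 hz.2 i rfl
      refine ⟨z * x * z⁻¹ * x⁻¹, H.mul_mem (H.mul_mem (H.mul_mem hz.1 hx) (H.inv_mem hz.1))
        (H.inv_mem hx), fun k hk => ?_, fun h => hs ?_⟩
      · rcases Finset.mem_insert.1 hk with rfl | hk
        · simp [hzi]
        · simp [hxA k hk]
      · simpa [mul_inv_eq_iff_eq_mul] using h
  have := Fintype.ofFinite ι
  rw [eq_top_iff]
  refine fun x _ => Subgroup.pi_mem_of_mulSingle_mem x fun j => ?_
  obtain ⟨K, hK, hKm⟩ := hker {j}ᶜ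
  obtain ⟨y, hy, hyA, hyj⟩ := step j (Finset.univ.erase j) (by simp)
  obtain ⟨z, hz, hzj⟩ := normal_image K hK j
    ⟨y, ⟨hy, (hKm y).2 fun i hi => hyA i (by simpa using hi)⟩, hyj⟩ (x j)
  have hxz : Pi.mulSingle j (x j) = z := by
    funext i
    rcases eq_or_ne i j with rfl | hij
    · simp [hzj]
    · simp [hij, (hKm z).1 hz.2 i hij]
  exact hxz ▸ hz.1

/-- A family of generating pairs of the alternating group, pairwise inequivalent in the sense that
no two of them satisfy the same relations, generates the full direct power. -/
theorem exists_closure_pair_eq_top_of_separated {α ι : Type*} [Fintype α] [DecidableEq α]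
    [Finite ι] (hα : 5 ≤ Fintype.card α) (g h : ι → Perm α)
    (gen : ∀ i, Subgroup.closure {g i, h i} = alternatingGroup α)
    (sep : ∀ i j, i ≠ j → ∃ p ∈ Subgroup.closure {(g i, g j), (h i, h j)},
      (p.1 = 1 ∧ p.2 ≠ 1) ∨ (p.1 ≠ 1 ∧ p.2 = 1)) :
    ∃ x y : ι → alternatingGroup α, Subgroup.closure {x, y} = ⊤ := by
  have hg : ∀ i, g i ∈ alternatingGroup α := fun i => gen i ▸ Subgroup.subset_closure (by simp)
  have hh : ∀ i, h i ∈ alternatingGroup α := fun i => gen i ▸ Subgroup.subset_closure (by simp)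
  let x : ι → alternatingGroup α := fun i => ⟨g i, hg i⟩
  let y : ι → alternatingGroup α := fun i => ⟨h i, hh i⟩
  have hsimple : IsSimpleGroup (alternatingGroup α) := by
    apply alternatingGroup.isSimpleGroup
    simpa using hα
  have surj : ∀ i s, ∃ z ∈ Subgroup.closure {x, y}, z i = s := by
    intro i s
    have hmap := MonoidHom.map_closure
      ((alternatingGroup α).subtype.comp (Pi.evalMonoidHom (fun _ => alternatingGroup α) i)) {x, y}
    rw [Set.image_pair] at hmap
    have hs : (s : Perm α) ∈ Subgroup.closure {g i, h i} := (gen i).symm ▸ s.2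
    obtain ⟨z, hz, hzs⟩ := (hmap ▸ hs : (s : Perm α) ∈ (Subgroup.closure {x, y}).map _)
    exact ⟨z, hz, Subtype.ext hzs⟩
  have lift : ∀ i j, ∀ p ∈ Subgroup.closure {(g i, g j), (h i, h j)},
      ∃ z ∈ Subgroup.closure {x, y}, (z i : Perm α) = p.1 ∧ (z j : Perm α) = p.2 := by
    intro i j p hp
    have hmap := MonoidHom.map_closure
      (((alternatingGroup α).subtype.comp (Pi.evalMonoidHom (fun _ => alternatingGroup α) i)).prod
      ((alternatingGroup α).subtype.comp (Pi.evalMonoidHom (fun _ => alternatingGroup α) j))) {x, y}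
    rw [Set.image_pair] at hmap
    obtain ⟨z, hz, rfl⟩ := (hmap ▸ hp : p ∈ (Subgroup.closure {x, y}).map _)
    exact ⟨z, hz, rfl, rfl⟩
  refine ⟨x, y, Subgroup.eq_top_of_pairwise_separating
    (alternatingGroup.center_eq_bot (by simpa using (by lia : 4 ≤ Fintype.card α))) _ surj
    fun i j hij => ?_⟩
  · obtain ⟨p, hp, h1⟩ := sep i j hij
    obtain ⟨z, hz, hzi, hzj⟩ := lift i j p hp
    rcases h1 with ⟨h1, h2⟩ | ⟨h1, h2⟩
    · exact ⟨z, hz, Subtype.ext (by simp [hzi, h1]), fun h => h2 (by rw [← hzj, h]; rfl)⟩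
    · have hN : (((Pi.evalMonoidHom (fun _ => alternatingGroup α) j).ker ⊓
          Subgroup.closure {x, y} : Subgroup _).map (Pi.evalMonoidHom (fun _ => alternatingGroup α) i)).Normal := by
        constructor
        rintro _ ⟨u, hu, rfl⟩ t
        obtain ⟨v, hv, rfl⟩ := surj i t
        refine ⟨v * u * v⁻¹, ⟨(MonoidHom.normal_ker _).conj_mem _ hu.1 _, ?_⟩, by simp⟩
        exact Subgroup.mul_mem _ (Subgroup.mul_mem _ hv hu.2) (Subgroup.inv_mem _ hv)
      have htop := hN.eq_bot_or_eq_top.resolve_left fun hbot => by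
        have : z i ∈ (⊥ : Subgroup (alternatingGroup α)) := by
          rw [← hbot]
          exact ⟨z, ⟨Subtype.ext (by simpa using hzj.trans h2), hz⟩, rfl⟩
        exact h1 (by rw [← hzi, Subgroup.mem_bot.1 this]; rfl)
      have : Nontrivial (alternatingGroup α) := hsimple.toNontrivial
      obtain ⟨s, hs⟩ := exists_ne (1 : alternatingGroup α)
      obtain ⟨u, hu, hus⟩ := surj j s
      obtain ⟨v, hv, hvi⟩ := (htop ▸ Subgroup.mem_top (u i) : u i ∈ Subgroup.map _ _)
      refine ⟨u * v⁻¹, mul_mem hu (inv_mem hv.2), ?_, ?_⟩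
      · have : v i = u i := hvi
        simp [this]
      · have : v j = 1 := hv.1
        simp [this, hus, hs]

/-- The three-cycle `(a b x)`. -/
def threeCycle {α : Type*} [DecidableEq α] (a b x : α) : Perm α := swap a b * swap b x

section threeCycle

variable {α : Type*} [DecidableEq α] {a b x y : α}

theorem conj_threeCycle (σ : Perm α) (a b x : α) :
    σ * threeCycle a b x * σ⁻¹ = threeCycle (σ a) (σ b) (σ x) := by
  simp only [threeCycle, swap_apply_apply]
  group

theorem threeCycle_swap (ha : x ≠ a) (hb : x ≠ b) :
    threeCycle b a x = (threeCycle a b x)⁻¹ := by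
  have h := swap_apply_apply (swap a b) b x
  rw [swap_apply_right, swap_apply_of_ne_of_ne ha hb] at h
  simp only [threeCycle, mul_inv_rev, swap_inv, h, swap_comm b a]
  simp [mul_assoc]

theorem threeCycle_apply_mid (ha : x ≠ a) (hb : x ≠ b) : threeCycle a b x b = x := by
  simp [threeCycle, swap_apply_of_ne_of_ne ha hb]

theorem threeCycle_inv_apply_mid (ha : x ≠ a) (hab : a ≠ b) : (threeCycle a b x)⁻¹ b = a := by
  rw [inv_eq_iff_eq]
  simp [threeCycle, swap_apply_def, ha.symm, hab]

theorem threeCycle_pow_three (ha : x ≠ a) (hb : x ≠ b) (hab : a ≠ b) :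
    threeCycle a b x ^ 3 = 1 := by
  ext z
  simp only [threeCycle, pow_succ, pow_zero, one_mul, mul_apply, swap_apply_def, one_apply]
  grind

theorem threeCycle_mul_threeCycle_sq (hxa : x ≠ a) (hxb : x ≠ b) (hya : y ≠ a) (hyb : y ≠ b)
    (hab : a ≠ b) (hxy : x ≠ y) : (threeCycle a b x * threeCycle a b y) ^ 2 = 1 := by
  ext z
  simp only [threeCycle, pow_two, mul_apply, swap_apply_def, one_apply]
  grind

theorem threeCycle_mul_threeCycle_inv_sq (hxa : x ≠ a) (hxb : x ≠ b) (hya : y ≠ a) (hyb : y ≠ b)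
    (hxy : x ≠ y) : (threeCycle a b x * (threeCycle a b y)⁻¹) ^ 2 ≠ 1 := by
  intro h
  have := congrArg (fun σ : Perm α => σ a) h
  simp only [threeCycle, pow_two, mul_apply, swap_apply_def, one_apply, mul_inv_rev, swap_inv] at this
  grind

theorem sign_threeCycle [Fintype α] (hb : x ≠ b) (hab : a ≠ b) : sign (threeCycle a b x) = 1 := by
  simp [threeCycle, sign_swap hab, sign_swap hb.symm]

theorem alternatingGroup_le_of_threeCycle_mem [Fintype α] (hab : a ≠ b) (L : Subgroup (Perm α))
    (hL : ∀ x, x ≠ a → x ≠ b → threeCycle a b x ∈ L) : alternatingGroup α ≤ L := by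
  set K := L ⊓ alternatingGroup α
  have hK : ∀ x, x ≠ a → x ≠ b → threeCycle a b x ∈ K := fun x ha hb =>
    ⟨hL x ha hb, sign_threeCycle hb hab⟩
  have inv_mem : ∀ x, x ≠ a → x ≠ b → swap b x * swap a b ∈ K := fun x ha hb => by
    have := K.inv_mem (hK x ha hb)
    simpa [threeCycle] using this
  have key : ∀ x y, x ≠ y → swap a b * swap x y ∈ K := by
    have hb : ∀ y, y ≠ b → swap a b * swap b y ∈ K := fun y hy => by
      rcases eq_or_ne y a with rfl | hya
      · simp [swap_comm b y]
      · exact hK y hya hy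
    have ha : ∀ y, y ≠ a → swap a b * swap a y ∈ K := fun y hy => by
      rcases eq_or_ne y b with rfl | hyb
      · simp
      · have h := swap_apply_apply (swap a b) b y
        rw [swap_apply_right, swap_apply_of_ne_of_ne hy hyb] at h
        have := inv_mem y hy hyb
        rw [h]
        simpa [mul_assoc] using this
    intro x y hxy
    by_cases hxa : x = a
    · subst hxa; exact ha y hxy.symm
    by_cases hxb : x = b
    · subst hxb; exact hb y hxy.symm
    by_cases hya : y = a
    · subst hya; rw [swap_comm x]; exact ha x hxy
    by_cases hyb : y = b
    · subst hyb; rw [swap_comm x]; exact hb x hxy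
    have h := swap_apply_apply (swap b x) b y
    rw [swap_apply_left, swap_apply_of_ne_of_ne hyb hxy.symm] at h
    have := K.mul_mem (K.mul_mem (hK x hxa hxb) (inv_mem y hya hyb)) (hK x hxa hxb)
    rw [h]
    simpa [threeCycle, mul_assoc] using this
  have either : ∀ σ : Perm α, σ ∈ K ∨ swap a b * σ ∈ K := by
    intro σ
    induction σ using swap_induction_on with
    | one => exact Or.inl K.one_mem
    | swap_mul σ x y hxy ih =>
      rcases ih with h | h
      · exact Or.inr (by simpa [mul_assoc] using K.mul_mem (key x y hxy) h)
      · exact Or.inl (by simpa [mul_assoc] using K.mul_mem (K.inv_mem (key x y hxy)) h)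
  intro σ hσ
  rcases either σ with h | h
  · exact h.1
  · have := mem_alternatingGroup.1 h.2
    rw [Perm.sign_mul, sign_swap hab, mem_alternatingGroup.1 hσ] at this
    exact absurd this (by decide)

end threeCycle

/-- Conjugation by `h` sends the three-cycle `(a b x)` to `(a b y)` or to its inverse. -/
def ConjThreeCycle {α : Type*} [DecidableEq α] (a b : α) (h : Perm α) (x y : α) : Prop :=
  y ≠ a ∧ y ≠ b ∧ (h * threeCycle a b x * h⁻¹ = threeCycle a b y ∨
    h * threeCycle a b x * h⁻¹ = (threeCycle a b y)⁻¹)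

/-- Every set of points that contains `d`, is stable under `c`, and is stable under the common
part of the partial actions of `h₁` and `h₂` on three-cycles `(a b x)`, contains all points
other than `a` and `b`. -/
def Spreads {α : Type*} [DecidableEq α] (a b d : α) (c h₁ h₂ : Perm α) : Prop :=
  ∀ Z : Set α, d ∈ Z → (∀ x ∈ Z, c x ∈ Z) →
    (∀ x ∈ Z, ∀ y y', ConjThreeCycle a b h₁ x y → ConjThreeCycle a b h₂ x y' →
      (y = y' ∨ y ∈ Z ∨ y' ∈ Z) → y = y' ∧ y ∈ Z) →
    ∀ x, x ≠ a → x ≠ b → x ∈ Z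

section core

variable {α : Type*} [DecidableEq α] {a b d : α} {c h₁ h₂ : Perm α}

theorem threeCycle_prod_mem (hab : a ≠ b) (hda : d ≠ a) (hdb : d ≠ b) (hca : c a = a)
    (hcb : c b = b) (P : Subgroup (Perm α × Perm α))
    (hP : ∀ p ∈ P, p.1 = 1 ↔ p.2 = 1) (hd : (threeCycle a b d, threeCycle a b d) ∈ P)
    (hc : (c, c) ∈ P) (hh : (h₁, h₂) ∈ P) (hs : Spreads a b d c h₁ h₂) (x : α) (hxa : x ≠ a)
    (hxb : x ≠ b) : (threeCycle a b x, threeCycle a b x) ∈ P := by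
  have inj : ∀ u v w, (u, v) ∈ P → (u, w) ∈ P → v = w := fun u v w h1 h2 => by
    have h := P.mul_mem h1 (P.inv_mem h2)
    exact mul_inv_eq_one.1 ((hP _ h).1 (mul_inv_cancel u))
  have inj' : ∀ u v w, (v, u) ∈ P → (w, u) ∈ P → v = w := fun u v w h1 h2 => by
    have h := P.mul_mem h1 (P.inv_mem h2)
    exact mul_inv_eq_one.1 ((hP _ h).2 (mul_inv_cancel u))
  have mid : ∀ y y', y ≠ a → y ≠ b → y' ≠ a → y' ≠ b →
      threeCycle a b y ≠ (threeCycle a b y')⁻¹ := fun y y' ha hb ha' _ h => by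
    have := congrArg (fun σ : Perm α => σ b) h
    simp only [threeCycle_apply_mid ha hb, threeCycle_inv_apply_mid ha' hab] at this
    exact ha this
  have ori : ∀ y, y ≠ a → y ≠ b → (threeCycle a b y, (threeCycle a b y)⁻¹) ∉ P := by
    intro y ha hb h
    rcases eq_or_ne d y with rfl | hdy
    · exact mid d d ha hb ha hb (inj _ _ _ hd h)
    · have h2 := (hP _ (P.pow_mem (P.mul_mem hd h) 2)).1
        (threeCycle_mul_threeCycle_sq hda hdb ha hb hab hdy)
      exact threeCycle_mul_threeCycle_inv_sq hda hdb ha hb hdy h2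
  have eq_of : ∀ y y', y ≠ a → y ≠ b → y' ≠ a → y' ≠ b →
      threeCycle a b y = threeCycle a b y' → y = y' := fun y y' ha hb ha' hb' h => by
    have := congrArg (fun σ : Perm α => σ b) h
    simpa only [threeCycle_apply_mid ha hb, threeCycle_apply_mid ha' hb'] using this
  refine (hs {x | x ≠ a ∧ x ≠ b ∧ (threeCycle a b x, threeCycle a b x) ∈ P} ⟨hda, hdb, hd⟩ ?_ ?_
    x hxa hxb).2.2
  · rintro x ⟨ha, hb, hx⟩
    refine ⟨fun h => ha (c.injective (h.trans hca.symm)),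
      fun h => hb (c.injective (h.trans hcb.symm)), ?_⟩
    have := P.mul_mem (P.mul_mem hc hx) (P.inv_mem hc)
    have hcx := conj_threeCycle c a b x
    rw [hca, hcb] at hcx
    rw [← hcx]
    exact this
  · rintro x ⟨ha, hb, hx⟩ y y' ⟨hya, hyb, hy⟩ ⟨hya', hyb', hy'⟩ hyy
    have hconj : (h₁ * threeCycle a b x * h₁⁻¹, h₂ * threeCycle a b x * h₂⁻¹) ∈ P :=
      P.mul_mem (P.mul_mem hh hx) (P.inv_mem hh)
    have hcases : (threeCycle a b y, threeCycle a b y') ∈ P ∨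
        (threeCycle a b y, (threeCycle a b y')⁻¹) ∈ P := by
      rcases hy with hy | hy <;> rcases hy' with hy' | hy' <;> rw [hy, hy'] at hconj
      · exact Or.inl hconj
      · exact Or.inr hconj
      · exact Or.inr (by simpa using P.inv_mem hconj)
      · exact Or.inl (by simpa using P.inv_mem hconj)
    rcases hcases with h | h
    · have heq : y = y' := by
        rcases hyy with h' | h' | h'
        · exact h'
        · exact eq_of _ _ hya hyb hya' hyb' (inj _ _ _ h'.2.2 h)
        · exact eq_of _ _ hya hyb hya' hyb' (inj' _ _ _ h h'.2.2)
      subst heq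
      exact ⟨rfl, hya, hyb, h⟩
    · exfalso
      rcases hyy with rfl | h' | h'
      · exact ori y hya hyb h
      · exact mid _ _ hya hyb hya' hyb' (inj _ _ _ h'.2.2 h)
      · exact mid _ _ hya hyb hya' hyb' (inj' _ _ _ h (P.inv_mem h'.2.2))

theorem exists_pow_threeCycle_mul_eq (hab : a ≠ b) (hda : d ≠ a) (hdb : d ≠ b) (hca : c a = a)
    (hcb : c b = b) (hcd : c d = d) {q : ℕ} (hq : c ^ q = 1) (hq3 : ¬ 3 ∣ q) :
    (threeCycle a b d * c) ^ (q * q) = threeCycle a b d := by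
  have hcomm : Commute (threeCycle a b d) c := by
    have h := conj_threeCycle c a b d
    rw [hca, hcb, hcd, mul_inv_eq_iff_eq_mul] at h
    exact h.symm
  have hmod : q * q % 3 = 1 := by
    have : q % 3 = 1 ∨ q % 3 = 2 := by lia
    rcases this with h | h <;> simp [Nat.mul_mod, h]
  rw [hcomm.mul_pow, pow_mul c, hq, one_pow, mul_one, ← Nat.div_add_mod (q * q) 3, hmod, pow_add,
    pow_mul, threeCycle_pow_three hda hdb hab, one_pow, one_mul, pow_one]

theorem exists_closure_pair_eq_top_of_spreads [Fintype α] (hα : 5 ≤ Fintype.card α) {ι : Type*}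
    [Finite ι] (hab : a ≠ b) (hda : d ≠ a) (hdb : d ≠ b) (hca : c a = a)
    (hcb : c b = b) (hcd : c d = d) {q : ℕ} (hq : c ^ q = 1) (hq3 : ¬ 3 ∣ q) (hc : sign c = 1)
    (h : ι → Perm α) (hinj : Function.Injective h) (hsign : ∀ i, sign (h i) = 1)
    (hs : ∀ i j, Spreads a b d c (h i) (h j)) :
    ∃ x y : ι → alternatingGroup α, Subgroup.closure {x, y} = ⊤ := by
  set g := threeCycle a b d * c
  have diag : ∀ i j, (∀ p ∈ Subgroup.closure {(g, g), (h i, h j)}, p.1 = 1 ↔ p.2 = 1) →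
      ∀ σ ∈ alternatingGroup α, (σ, σ) ∈ Subgroup.closure {(g, g), (h i, h j)} := by
    intro i j hP
    set P := Subgroup.closure {(g, g), (h i, h j)}
    have hg : (g, g) ∈ P := Subgroup.subset_closure (by simp)
    have hd : (threeCycle a b d, threeCycle a b d) ∈ P := by
      have := P.pow_mem hg (q * q)
      rw [Prod.pow_mk, exists_pow_threeCycle_mul_eq hab hda hdb hca hcb hcd hq hq3] at this
      exact this
    have hcP : (c, c) ∈ P := by
      have := P.mul_mem (P.inv_mem hd) hg
      simpa [g] using this
    exact alternatingGroup_le_of_threeCycle_mem hab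
      (P.comap ((MonoidHom.id (Perm α)).prod (MonoidHom.id (Perm α)))) fun x hxa hxb =>
      threeCycle_prod_mem hab hda hdb hca hcb P hP hd hcP (Subgroup.subset_closure (by simp))
        (hs i j) x hxa hxb
  refine exists_closure_pair_eq_top_of_separated hα (fun _ => g) h (fun i => le_antisymm ?_ ?_) ?_
  · rw [Subgroup.closure_le]
    rintro _ (rfl | rfl)
    · simp [g, sign_threeCycle hdb hab, hc]
    · exact hsign i
  · intro σ hσ
    have hP : ∀ p ∈ Subgroup.closure {(g, g), (h i, h i)}, p.1 = p.2 := fun p hp => by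
      have hle : Subgroup.closure {(g, g), (h i, h i)} ≤
          (MonoidHom.fst (Perm α) (Perm α)).eqLocus (MonoidHom.snd (Perm α) (Perm α)) := by
        rw [Subgroup.closure_le]
        rintro _ (rfl | rfl) <;> rfl
      exact hle hp
    have hmem := diag i i (fun p hp => by rw [hP p hp]) σ hσ
    have hmap := MonoidHom.map_closure (MonoidHom.fst (Perm α) (Perm α)) {(g, g), (h i, h i)}
    rw [Set.image_pair] at hmap
    exact hmap ▸ ⟨_, hmem, rfl⟩
  · intro i j hij
    by_contra hcon
    push Not at hcon
    have hP := fun p hp => iff_def.2 ⟨(hcon p hp).1, not_imp_not.1 (hcon p hp).2⟩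
    have h1 := diag i j hP (h i) (hsign i)
    have h2 : (h i, h j) ∈ Subgroup.closure {(g, g), (h i, h j)} :=
      Subgroup.subset_closure (by simp)
    have h3 := Subgroup.mul_mem _ (Subgroup.inv_mem _ h1) h2
    exact hij (hinj (inv_mul_eq_one.1 ((hP _ h3).1 (inv_mul_cancel _))))

end core

section ConjThreeCycle

variable {α : Type*} [DecidableEq α] {a b x y : α} {σ : Perm α}

theorem ConjThreeCycle.eq_apply (hab : a ≠ b) (hxa : x ≠ a) (hxb : x ≠ b)
    (hσ : σ a = a ∧ σ b = b ∨ σ a = b ∧ σ b = a) (h : ConjThreeCycle a b σ x y) : y = σ x := by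
  obtain ⟨hya, hyb, h⟩ := h
  have hne : σ x ≠ a ∧ σ x ≠ b := by
    have h1 := σ.injective.ne hxa
    have h2 := σ.injective.ne hxb
    rcases hσ with ⟨h3, h4⟩ | ⟨h3, h4⟩ <;> rw [h3] at h1 <;> rw [h4] at h2
    exacts [⟨h1, h2⟩, ⟨h2, h1⟩]
  have hconj : threeCycle a b (σ x) = threeCycle a b y ∨
      threeCycle a b (σ x) = (threeCycle a b y)⁻¹ := by
    rw [conj_threeCycle] at h
    rcases hσ with ⟨h3, h4⟩ | ⟨h3, h4⟩ <;> rw [h3, h4] at h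
    · exact h
    · rw [threeCycle_swap hne.1 hne.2, inv_eq_iff_eq_inv, inv_inj] at h
      exact h.symm
  rcases hconj with h | h <;> have hb := congrArg (fun σ : Perm α => σ b) h
  · simpa only [threeCycle_apply_mid hne.1 hne.2, threeCycle_apply_mid hya hyb, eq_comm] using hb
  · simp only [threeCycle_apply_mid hne.1 hne.2, threeCycle_inv_apply_mid hya hab] at hb
    exact absurd hb hne.1

theorem conjThreeCycle_apply (hxa : x ≠ a) (hxb : x ≠ b)
    (hσ : σ a = a ∧ σ b = b ∨ σ a = b ∧ σ b = a) : ConjThreeCycle a b σ x (σ x) := by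
  have hne : σ x ≠ a ∧ σ x ≠ b := by
    have h1 := σ.injective.ne hxa
    have h2 := σ.injective.ne hxb
    rcases hσ with ⟨h3, h4⟩ | ⟨h3, h4⟩ <;> rw [h3] at h1 <;> rw [h4] at h2
    exacts [⟨h1, h2⟩, ⟨h2, h1⟩]
  refine ⟨hne.1, hne.2, ?_⟩
  rw [conj_threeCycle]
  rcases hσ with ⟨h3, h4⟩ | ⟨h3, h4⟩ <;> rw [h3, h4]
  · exact Or.inl rfl
  · exact Or.inr (threeCycle_swap hne.1 hne.2)

end ConjThreeCycle

/-- The product of `σ` with a power of `swap a b` that is an even permutation. -/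
def evenAdjust {α : Type*} [DecidableEq α] [Fintype α] (a b : α) (σ : Perm α) : Perm α :=
  if sign σ = 1 then σ else σ * swap a b

section evenAdjust

variable {α : Type*} [DecidableEq α] [Fintype α] {a b : α} {σ τ : Perm α}

theorem sign_evenAdjust (hab : a ≠ b) : sign (evenAdjust a b σ) = 1 := by
  unfold evenAdjust
  split_ifs with h
  · exact h
  · simp [sign_swap hab, (Int.units_eq_one_or (sign σ)).resolve_left h]

theorem evenAdjust_apply {x : α} (ha : x ≠ a) (hb : x ≠ b) : evenAdjust a b σ x = σ x := by
  unfold evenAdjust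
  split_ifs with h
  · rfl
  · simp [swap_apply_of_ne_of_ne ha hb]

theorem evenAdjust_apply_left_right (ha : σ a = a) (hb : σ b = b) :
    evenAdjust a b σ a = a ∧ evenAdjust a b σ b = b ∨
      evenAdjust a b σ a = b ∧ evenAdjust a b σ b = a := by
  unfold evenAdjust
  split_ifs with h
  · exact Or.inl ⟨ha, hb⟩
  · exact Or.inr (by simp [ha, hb])

theorem eq_of_evenAdjust_eq (ha : σ a = a) (hb : σ b = b) (ha' : τ a = a) (hb' : τ b = b)
    (h : evenAdjust a b σ = evenAdjust a b τ) : σ = τ := by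
  ext x
  by_cases hxa : x = a
  · rw [hxa, ha, ha']
  by_cases hxb : x = b
  · rw [hxb, hb, hb']
  rw [← evenAdjust_apply hxa hxb, h, evenAdjust_apply hxa hxb]

end evenAdjust

/-- Families of permutations prescribed on the sets `D j` give a generating pair of a direct power
of the alternating group. -/
theorem exists_closure_pair_eq_top_of_families {α : Type*} [DecidableEq α] [Fintype α]
    {a b d : α} {c : Perm α} (hα : 5 ≤ Fintype.card α) (hab : a ≠ b) (hda : d ≠ a) (hdb : d ≠ b)
    (hca : c a = a) (hcb : c b = b) (hcd : c d = d) {q : ℕ} (hq : c ^ q = 1) (hq3 : ¬ 3 ∣ q)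
    (hc : sign c = 1) {J : Type*} [Fintype J] (σ : J → Perm α) (D : J → Finset α) {k N : ℕ}
    (hD : ∀ j, (D j).card ≤ k) (hN : N ≤ Fintype.card J * (Fintype.card α - k).factorial)
    (haD : ∀ j, a ∈ D j) (hbD : ∀ j, b ∈ D j) (hσa : ∀ j, σ j a = a) (hσb : ∀ j, σ j b = b)
    (hJ : ∀ i j (f : Perm α), (∀ x ∈ D i, f x = σ i x) → (∀ x ∈ D j, f x = σ j x) → i = j)
    (hs : ∀ i j (Z : Set α) (f₁ f₂ : Perm α), d ∈ Z → (∀ x ∈ Z, c x ∈ Z) →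
      (∀ x ∈ D i, f₁ x = σ i x) → (∀ x ∈ D j, f₂ x = σ j x) →
      (∀ x ∈ Z, x ≠ a → x ≠ b → (f₁ x = f₂ x ∨ f₁ x ∈ Z ∨ f₂ x ∈ Z) → f₁ x = f₂ x ∧ f₁ x ∈ Z) →
      ∀ x, x ≠ a → x ≠ b → x ∈ Z) :
    ∃ x y : Fin N → alternatingGroup α, Subgroup.closure {x, y} = ⊤ := by
  let f : (Σ j, Perm {x // x ∉ D j}) → Perm α := fun i => σ i.1 * ofSubtype i.2
  have hfD : ∀ i, ∀ x ∈ D i.1, f i x = σ i.1 x := fun i x hx => by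
    simp [f, ofSubtype_apply_of_not_mem i.2 (not_not.2 hx)]
  have hfa : ∀ i, f i a = a := fun i => (hfD i a (haD _)).trans (hσa _)
  have hfb : ∀ i, f i b = b := fun i => (hfD i b (hbD _)).trans (hσb _)
  have hcard : Fintype.card (Fin N) ≤ Fintype.card (Σ j, Perm {x // x ∉ D j}) := by
    rw [Fintype.card_fin, Fintype.card_sigma]
    refine hN.trans ?_
    rw [← Finset.card_univ (α := J), ← smul_eq_mul]
    refine Finset.card_nsmul_le_sum _ _ _ fun j _ => ?_
    rw [Fintype.card_perm]
    refine Nat.factorial_le ?_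
    rw [Fintype.card_subtype_compl]
    simpa using Nat.sub_le_sub_left (hD j) _
  obtain ⟨e⟩ := Function.Embedding.nonempty_of_card_le hcard
  refine exists_closure_pair_eq_top_of_spreads hα hab hda hdb hca hcb hcd hq hq3 hc
    (fun n => evenAdjust a b (f (e n))) (fun m n hmn => ?_) (fun n => sign_evenAdjust hab)
    fun m n Z hdZ hcZ hZ => ?_
  · have hf := eq_of_evenAdjust_eq (hfa _) (hfb _) (hfa _) (hfb _) hmn
    have hfst := hJ (e m).1 (e n).1 (f (e m)) (hfD _) (hf ▸ hfD _)
    refine e.injective ?_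
    generalize e m = u at *
    generalize e n = v at *
    obtain ⟨i, s⟩ := u
    obtain ⟨j, t⟩ := v
    obtain rfl : i = j := hfst
    obtain rfl : s = t := ofSubtype_injective (mul_left_cancel hf)
    rfl
  · refine hs (e m).1 (e n).1 Z (f (e m)) (f (e n)) hdZ hcZ (hfD _) (hfD _)
      fun x hx hxa hxb h => ?_
    have h1 := conjThreeCycle_apply hxa hxb
      (evenAdjust_apply_left_right (hfa (e m)) (hfb (e m)))
    have h2 := conjThreeCycle_apply hxa hxb
      (evenAdjust_apply_left_right (hfa (e n)) (hfb (e n)))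
    rw [evenAdjust_apply hxa hxb] at h1 h2
    exact hZ x hx _ _ h1 h2 h

/-- The rotation of the points `k, …, n - 1` of `Fin n`. -/
def tailRotation (n k : ℕ) (hk : k < n) : Perm (Fin n) :=
  Fin.cycleIcc ⟨k, hk⟩ ⟨n - 1, by lia⟩

section tailRotation

variable {n k : ℕ} {hk : k < n}

theorem tailRotation_of_lt {x : Fin n} (hx : x.val < k) : tailRotation n k hk x = x :=
  Fin.cycleIcc_of_lt (by simpa [Fin.lt_def] using hx)

theorem tailRotation_of_le {x : ℕ} (hkx : k ≤ x) (hx : x + 1 < n) :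
    tailRotation n k hk ⟨x, by lia⟩ = ⟨x + 1, hx⟩ := by
  have : NeZero n := ⟨by lia⟩
  rw [tailRotation, Fin.cycleIcc_of_ge_of_lt (by simpa [Fin.le_def] using hkx)
    (by rw [Fin.lt_def]; simp only; lia)]
  ext
  rw [Fin.val_add_one_of_lt']
  exact hx

theorem sign_tailRotation : sign (tailRotation n k hk) = (-1) ^ (n - 1 - k) :=
  Fin.sign_cycleIcc_of_le (by rw [Fin.le_def]; simp only; lia)

theorem tailRotation_pow (h : k + 1 < n) : tailRotation n k hk ^ (n - k) = 1 := by
  have h1 := Fin.cycleType_cycleIcc_of_lt (i := ⟨k, hk⟩) (j := (⟨n - 1, by lia⟩ : Fin n))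
    (by rw [Fin.lt_def]; simp only; lia)
  have h2 : orderOf (tailRotation n k hk) = n - k := by
    rw [← lcm_cycleType, tailRotation, h1, Multiset.lcm_singleton]
    simp only [normalize_eq]
    lia
  rw [← h2, pow_orderOf_eq_one]

theorem mem_of_tailRotation_mem {Z : Set (Fin n)} (h0 : ⟨k, hk⟩ ∈ Z)
    (hZ : ∀ x ∈ Z, k ≤ x.val → x.val + 1 < n → tailRotation n k hk x ∈ Z) (x : ℕ) (hx : x < n) (hkx : k ≤ x) :
    (⟨x, hx⟩ : Fin n) ∈ Z := by
  induction x, hkx using Nat.le_induction with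
  | base => exact h0
  | succ m hm ih =>
    have := hZ _ (ih (by lia)) hm hx
    rwa [tailRotation_of_le hm hx] at this

end tailRotation

theorem exists_closure_pair_eq_top_of_tailRotation {n : ℕ} (hn : 5 ≤ n) {c : Perm (Fin n)}
    (hca : c ⟨0, by lia⟩ = ⟨0, by lia⟩) (hcb : c ⟨1, by lia⟩ = ⟨1, by lia⟩)
    (hcd : c ⟨2, by lia⟩ = ⟨2, by lia⟩) {q : ℕ} (hq : c ^ q = 1) (hq3 : ¬ 3 ∣ q)
    (hc : sign c = 1) (D : Finset (Fin n)) {k : ℕ} (hD : D.card ≤ k)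
    (hN : 2 ^ n ≤ (n - k).factorial) (ha : ⟨0, by lia⟩ ∈ D) (hb : ⟨1, by lia⟩ ∈ D)
    (hs : ∀ Z : Set (Fin n), ⟨2, by lia⟩ ∈ Z → (∀ x ∈ Z, c x ∈ Z) →
      (∀ x : ℕ, ∀ hx : x + 1 < n, 2 ≤ x → ⟨x, by lia⟩ ∈ D → ⟨x, by lia⟩ ∈ Z → ⟨x + 1, hx⟩ ∈ Z) →
      ∀ x : ℕ, ∀ hx : x < n, 2 ≤ x → ⟨x, hx⟩ ∈ Z) :
    ∃ x y : Fin (2 ^ n) → alternatingGroup (Fin n), Subgroup.closure {x, y} = ⊤ := by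
  refine exists_closure_pair_eq_top_of_families (by simpa using hn) (by simp) (by simp) (by simp)
    hca hcb hcd hq hq3 hc (J := Unit) (fun _ => tailRotation n 2 (by lia)) (fun _ => D)
    (fun _ => hD) (by simpa using hN) (fun _ => ha) (fun _ => hb)
    (fun _ => tailRotation_of_lt (by simp)) (fun _ => tailRotation_of_lt (by simp))
    (fun _ _ _ _ _ => rfl) fun _ _ Z f₁ f₂ h2 hcZ h₁ h₂ hZ x hxa hxb => ?_
  refine hs Z h2 hcZ (fun x hx hx2 hxD hxZ => ?_) x.1 x.2 ?_
  · have := (hZ _ hxZ (by rw [Ne, Fin.ext_iff]; simp only; lia)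
      (by rw [Ne, Fin.ext_iff]; simp only; lia) (Or.inl ((h₁ _ hxD).trans (h₂ _ hxD).symm))).2
    rwa [h₁ _ hxD, tailRotation_of_le hx2 hx] at this
  · rw [Ne, Fin.ext_iff] at hxa hxb
    simp only at hxa hxb
    lia

theorem two_pow_le_factorial_sub {n m k : ℕ} (hm : 2 ^ m ≤ (m - k).factorial) (hk : k + 1 < m)
    (hn : m ≤ n) : 2 ^ n ≤ (n - k).factorial := by
  induction n, hn using Nat.le_induction with
  | base => exact hm
  | succ n hn ih =>
    rw [show n + 1 - k = (n - k) + 1 by lia, Nat.factorial_succ, pow_succ, mul_comm]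
    exact Nat.mul_le_mul (by lia) ih

theorem exists_closure_pair_eq_top_of_ten_le {n : ℕ} (hn : 10 ≤ n) :
    ∃ x y : Fin (2 ^ n) → alternatingGroup (Fin n), Subgroup.closure {x, y} = ⊤ := by
  have hcases : (n % 2 = 0 ∧ n % 3 ≠ 0) ∨ (n % 2 = 1 ∧ n % 3 ≠ 1 ∧ 11 ≤ n) ∨
    (n % 6 = 1 ∧ 11 ≤ n) ∨ (n % 6 = 0 ∧ 12 ≤ n) := by lia
  rcases hcases with h | h | h | h
  · refine exists_closure_pair_eq_top_of_tailRotation (by lia) (c := tailRotation n 3 (by lia))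
      (tailRotation_of_lt (by simp)) (tailRotation_of_lt (by simp)) (tailRotation_of_lt (by simp))
      (tailRotation_pow (by lia)) (by lia) ?_
      {⟨0, by lia⟩, ⟨1, by lia⟩, ⟨2, by lia⟩} Finset.card_le_three
      (two_pow_le_factorial_sub (m := 10) (by decide) (by lia) hn) (by simp) (by simp)
      fun Z h2 hc hD x hx hx2 => ?_
    · rw [sign_tailRotation, Even.neg_one_pow (by rw [Nat.even_iff]; lia)]
    · have h3 := hD 2 (by lia) le_rfl (by simp) h2
      rcases hx2.eq_or_lt with rfl | hx2
      · exact h2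
      · exact mem_of_tailRotation_mem h3 (fun x hx _ _ => hc x hx) x hx hx2
  · refine exists_closure_pair_eq_top_of_tailRotation (by lia) (c := tailRotation n 4 (by lia))
      (tailRotation_of_lt (by simp)) (tailRotation_of_lt (by simp)) (tailRotation_of_lt (by simp))
      (tailRotation_pow (by lia)) (by lia) ?_
      {⟨0, by lia⟩, ⟨1, by lia⟩, ⟨2, by lia⟩, ⟨3, by lia⟩} Finset.card_le_four
      (two_pow_le_factorial_sub (m := 11) (by decide) (by lia) h.2.2) (by simp) (by simp)
      fun Z h2 hc hD x hx hx2 => ?_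
    · rw [sign_tailRotation, Even.neg_one_pow (by rw [Nat.even_iff]; lia)]
    · have h3 := hD 2 (by lia) le_rfl (by simp) h2
      have h4 := hD 3 (by lia) (by lia) (by simp) h3
      rcases (by lia : x = 2 ∨ x = 3 ∨ 4 ≤ x) with rfl | rfl | hx2
      · exact h2
      · exact h3
      · exact mem_of_tailRotation_mem h4 (fun x hx _ _ => hc x hx) x hx hx2
  · have hfix : ∀ x : ℕ, ∀ hx : x < 5, (swap (⟨3, by lia⟩ : Fin n) ⟨4, by lia⟩ *
        tailRotation n 5 (by lia)) ⟨x, by lia⟩ = swap (⟨3, by lia⟩ : Fin n) ⟨4, by lia⟩ ⟨x, by lia⟩ :=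
      fun x hx => by rw [mul_apply, tailRotation_of_lt hx]
    have hcomm : Commute (swap (⟨3, by lia⟩ : Fin n) ⟨4, by lia⟩)
        (tailRotation n 5 (by lia)) := by
      have h := swap_apply_apply (tailRotation n 5 (by lia)) ⟨3, by lia⟩ ⟨4, by lia⟩
      rw [tailRotation_of_lt (by simp), tailRotation_of_lt (by simp), eq_mul_inv_iff_mul_eq] at h
      exact h
    refine exists_closure_pair_eq_top_of_tailRotation (by lia) (q := n - 5)
      (c := swap ⟨3, by lia⟩ ⟨4, by lia⟩ * tailRotation n 5 (by lia)) ?_ ?_ ?_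
      ?_ (by lia) ?_
      {⟨0, by lia⟩, ⟨1, by lia⟩, ⟨2, by lia⟩, ⟨4, by lia⟩} Finset.card_le_four
      (two_pow_le_factorial_sub (m := 11) (by decide) (by lia) h.2) (by simp) (by simp)
      fun Z h2 hc hD x hx hx2 => ?_
    · rw [hfix 0 (by lia), swap_apply_of_ne_of_ne (by simp) (by simp)]
    · rw [hfix 1 (by lia), swap_apply_of_ne_of_ne (by simp) (by simp)]
    · rw [hfix 2 (by lia), swap_apply_of_ne_of_ne (by simp) (by simp)]
    · rw [hcomm.mul_pow, tailRotation_pow (by lia), mul_one,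
        show n - 5 = 2 * ((n - 5) / 2) by lia, pow_mul, pow_two, swap_mul_self, one_pow]
    · rw [Perm.sign_mul, sign_swap (by simp), sign_tailRotation,
        Odd.neg_one_pow (by rw [Nat.odd_iff]; lia)]
      simp
    · have h3 := hD 2 (by lia) le_rfl (by simp) h2
      have h4 := hc _ h3
      rw [hfix 3 (by lia), swap_apply_left] at h4
      have h5 := hD 4 (by lia) (by lia) (by simp) h4
      rcases (by lia : x = 2 ∨ x = 3 ∨ x = 4 ∨ 5 ≤ x) with rfl | rfl | rfl | hx2
      · exact h2
      · exact h3
      · exact h4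
      · refine mem_of_tailRotation_mem h5 (fun x hx h5x hxn => ?_) x hx hx2
        have hcx := hc _ hx
        rw [mul_apply, tailRotation_of_le h5x hxn, swap_apply_of_ne_of_ne
          (by rw [Ne, Fin.ext_iff]; simp only; lia)
          (by rw [Ne, Fin.ext_iff]; simp only; lia)] at hcx
        rw [tailRotation_of_le h5x hxn]
        exact hcx
  · refine exists_closure_pair_eq_top_of_tailRotation (by lia) (c := tailRotation n 5 (by lia))
      (tailRotation_of_lt (by simp)) (tailRotation_of_lt (by simp)) (tailRotation_of_lt (by simp))
      (tailRotation_pow (by lia)) (by lia) ?_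
      {⟨0, by lia⟩, ⟨1, by lia⟩, ⟨2, by lia⟩, ⟨3, by lia⟩, ⟨4, by lia⟩} Finset.card_le_five
      (two_pow_le_factorial_sub (m := 12) (by decide) (by lia) h.2) (by simp) (by simp)
      fun Z h2 hc hD x hx hx2 => ?_
    · rw [sign_tailRotation, Even.neg_one_pow (by rw [Nat.even_iff]; lia)]
    · have h3 := hD 2 (by lia) le_rfl (by simp) h2
      have h4 := hD 3 (by lia) (by lia) (by simp) h3
      have h5 := hD 4 (by lia) (by lia) (by simp) h4
      rcases (by lia : x = 2 ∨ x = 3 ∨ x = 4 ∨ 5 ≤ x) with rfl | rfl | rfl | hx2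
      · exact h2
      · exact h3
      · exact h4
      · exact mem_of_tailRotation_mem h5 (fun x hx _ _ => hc x hx) x hx hx2

theorem exists_closure_pair_eq_top_nine :
    ∃ x y : Fin (2 ^ 9) → alternatingGroup (Fin 9), Subgroup.closure {x, y} = ⊤ := by
  refine exists_closure_pair_eq_top_of_families (a := 0) (b := 1) (d := 2) (q := 5) (k := 4)
    (c := tailRotation 9 4 (by lia)) (by simp) (by decide) (by decide) (by decide)
    (tailRotation_of_lt (by decide)) (tailRotation_of_lt (by decide))
    (tailRotation_of_lt (by decide)) (tailRotation_pow (by lia)) (by lia)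
    (by rw [sign_tailRotation]; rfl) (J := {y : Fin 9 // 4 ≤ y})
    (fun y => swap 2 4 * swap 3 y.1) (fun y => {0, 1, 2, y.1}) (fun _ => Finset.card_le_four)
    (by decide) (by simp) (by simp) (by decide) (by decide) (fun i j f hi hj => ?_)
    (fun i j Z f₁ f₂ h2 hc h₁ h₂ hZ x hx0 hx1 => ?_)
  · have h : ∀ y : {y : Fin 9 // 4 ≤ y}, (swap (2 : Fin 9) 4 * swap 3 y.1) y.1 = 3 := by decide
    refine Subtype.ext (f.injective ?_)
    rw [hi _ (by simp), hj _ (by simp), h i, h j]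
  · have hσ2 : ∀ y : {y : Fin 9 // 4 ≤ y}, (swap (2 : Fin 9) 4 * swap 3 y.1) 2 = 4 := by decide
    have hσy : ∀ y : {y : Fin 9 // 4 ≤ y}, (swap (2 : Fin 9) 4 * swap 3 y.1) y.1 = 3 := by decide
    have h4 : (4 : Fin 9) ∈ Z := by
      have := (hZ 2 h2 (by decide) (by decide) (Or.inl (by
        rw [h₁ 2 (by simp), h₂ 2 (by simp), hσ2, hσ2]))).2
      rwa [h₁ 2 (by simp), hσ2] at this
    have hge : ∀ y : Fin 9, 4 ≤ y → y ∈ Z := fun y hy =>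
      mem_of_tailRotation_mem (hk := by lia) h4 (fun x hx _ _ => hc x hx) y.1 y.2 hy
    have hσ0 : ∀ y : {y : Fin 9 // 4 ≤ y}, (swap (2 : Fin 9) 4 * swap 3 y.1) 0 = 0 := by decide
    have h0 : f₂ 0 = 0 := (h₂ 0 (by simp)).trans (hσ0 j)
    have hσ1 : ∀ y : {y : Fin 9 // 4 ≤ y}, (swap (2 : Fin 9) 4 * swap 3 y.1) 1 = 1 := by decide
    have h1 : f₂ 1 = 1 := (h₂ 1 (by simp)).trans (hσ1 j)
    have hj : f₂ j.1 = 3 := by rw [h₂ _ (by simp), hσy]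
    have h3 : (3 : Fin 9) ∈ Z := by
      have hi : f₁ i.1 = 3 := by rw [h₁ _ (by simp), hσy]
      have hi0 : i.1 ≠ 0 := fun h => absurd i.2 (by rw [h]; decide)
      have hi1 : i.1 ≠ 1 := fun h => absurd i.2 (by rw [h]; decide)
      have := hZ i.1 (hge _ i.2) hi0 hi1
      rw [hi] at this
      refine (this ?_).2
      have hne0 : f₂ i.1 ≠ 0 := fun h => hi0 (f₂.injective (h.trans h0.symm))
      have hne1 : f₂ i.1 ≠ 1 := fun h => hi1 (f₂.injective (h.trans h1.symm))
      have key : ∀ z : Fin 9, z ≠ 0 → z ≠ 1 → z = 2 ∨ 3 = z ∨ 4 ≤ z := by decide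
      rcases key _ hne0 hne1 with h | h | h
      · exact Or.inr (Or.inr (h ▸ h2))
      · exact Or.inl h
      · exact Or.inr (Or.inr (hge _ h))
    have key : ∀ z : Fin 9, z ≠ 0 → z ≠ 1 → z = 2 ∨ z = 3 ∨ 4 ≤ z := by decide
    rcases key x hx0 hx1 with rfl | rfl | h
    exacts [h2, h3, hge _ h]

theorem exists_closure_pair_eq_top_eight :
    ∃ x y : Fin (2 ^ 8) → alternatingGroup (Fin 8), Subgroup.closure {x, y} = ⊤ := by
  set D : Finset (Fin 8) := {0, 1, 2}
  set σ : Perm {x // x ∉ D} → Perm (Fin 8) := fun s => tailRotation 8 2 (by lia) * ofSubtype s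
  set t : Perm (Fin 8) := threeCycle 0 1 2
  have hσD : ∀ s, ∀ x ∈ D, σ s x = tailRotation 8 2 (by lia) x := fun s x hx => by
    simp [σ, ofSubtype_apply_of_not_mem s (not_not.2 hx)]
  have hσ0 : ∀ s, σ s 0 = 0 := fun s =>
    (hσD s 0 (by simp [D])).trans (tailRotation_of_lt (by decide))
  have hσ1 : ∀ s, σ s 1 = 1 := fun s =>
    (hσD s 1 (by simp [D])).trans (tailRotation_of_lt (by decide))
  have hσ2 : ∀ s, evenAdjust 0 1 (σ s) 2 = 3 := fun s =>
    (evenAdjust_apply (by decide) (by decide)).trans <|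
      (hσD s 2 (by simp [D])).trans (tailRotation_of_le (x := 2) le_rfl (by lia))
  have hcard : Fintype.card (Fin (2 ^ 8)) ≤ Fintype.card (Fin 3 × Perm {x // x ∉ D}) := by
    rw [Fintype.card_prod, Fintype.card_perm, show Fintype.card {x // x ∉ D} = 5 by rfl]
    simp [Nat.factorial]
  obtain ⟨e⟩ := Function.Embedding.nonempty_of_card_le hcard
  have hconj : ∀ (j : Fin 3) (s : Perm {x // x ∉ D}),
      ConjThreeCycle 0 1 (evenAdjust 0 1 (σ s) * t ^ j.1) 2 3 := fun j s => by
    have h := conjThreeCycle_apply (a := 0) (b := 1) (x := 2) (by decide) (by decide)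
      (evenAdjust_apply_left_right (hσ0 s) (hσ1 s))
    rw [hσ2] at h
    have hcomm : t ^ j.1 * threeCycle 0 1 2 * (t ^ j.1)⁻¹ = threeCycle 0 1 2 :=
      mul_inv_eq_iff_eq_mul.2 ((Commute.refl t).pow_left _).eq
    have hmul : (evenAdjust 0 1 (σ s) * t ^ j.1) * threeCycle 0 1 2 *
        (evenAdjust 0 1 (σ s) * t ^ j.1)⁻¹ =
        evenAdjust 0 1 (σ s) * threeCycle 0 1 2 * (evenAdjust 0 1 (σ s))⁻¹ := by
      conv_rhs => rw [← hcomm]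
      group
    rwa [ConjThreeCycle, hmul]
  have hinj : ∀ u v : Fin 3 × Perm {x // x ∉ D},
      evenAdjust 0 1 (σ u.2) * t ^ u.1.1 = evenAdjust 0 1 (σ v.2) * t ^ v.1.1 → u = v := by
    rintro ⟨i, s⟩ ⟨j, s'⟩ h
    simp only at h
    have hij : i = j := by
      have key : ∀ i j : Fin 3, (t ^ i.1)⁻¹ 2 = (t ^ j.1)⁻¹ 2 → i = j := by decide
      refine key i j ((evenAdjust 0 1 (σ s) * t ^ i.1).injective ?_)
      conv_rhs => rw [h]
      simp [hσ2]
    subst hij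
    have hσ := eq_of_evenAdjust_eq (hσ0 s) (hσ1 s) (hσ0 s') (hσ1 s') (mul_right_cancel h)
    rw [ofSubtype_injective (mul_left_cancel hσ)]
  refine exists_closure_pair_eq_top_of_spreads (a := 0) (b := 1) (d := 2) (q := 5)
    (c := tailRotation 8 3 (by lia)) (by simp) (by decide) (by decide) (by decide)
    (tailRotation_of_lt (by decide)) (tailRotation_of_lt (by decide))
    (tailRotation_of_lt (by decide)) (tailRotation_pow (by lia)) (by lia)
    (by rw [sign_tailRotation]; rfl)
    (fun n => evenAdjust 0 1 (σ (e n).2) * t ^ (e n).1.1) (fun m n hmn => e.injective ?_)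
    (fun n => ?_) fun m n Z h2 hc hZ x hx0 hx1 => ?_
  · exact hinj _ _ hmn
  · rw [Perm.sign_mul, sign_evenAdjust (by decide), map_pow,
      sign_threeCycle (by decide) (by decide), one_pow, one_mul]
  · have h3 := (hZ 2 h2 3 3 (hconj _ _) (hconj _ _) (Or.inl rfl)).2
    have key : ∀ z : Fin 8, z ≠ 0 → z ≠ 1 → z = 2 ∨ 3 ≤ z := by decide
    rcases key x hx0 hx1 with rfl | h
    · exact h2
    · exact mem_of_tailRotation_mem (hk := by lia) h3 (fun x hx _ _ => hc x hx) x.1 x.2 h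

/-- The self-map of `Fin 7` whose values are the base `7` digits of `c`. -/
def digitMap (c : ℕ) (x : Fin 7) : Fin 7 := Fin.ofNat 7 (c / 7 ^ x.val)

/-- The `m`-fold iterate of `digitMap c` followed by the translation by `j`. -/
def shiftedDigitMap (c : ℕ) (j : Fin 7) (m : ℕ) (x : Fin 7) : Fin 7 := (digitMap c)^[m] x + j

/-- A sufficient condition for `digitMap c` to be an even permutation that together with a
translation generates the alternating group. -/
def IsGenerating (c : ℕ) : Prop :=
  (∀ x y, digitMap c x = digitMap c y → x = y) ∧
    (∃ j, ∀ x, (shiftedDigitMap c j 1)^[5] x = x) ∧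
    ∃ j, ∃ m : Fin 3, (Finset.univ.filter fun x => (shiftedDigitMap c j m)^[4] x ≠ x).card = 3

instance : DecidablePred IsGenerating := fun c => by unfold IsGenerating; infer_instance

/-- Whether the permutations `x ↦ digitMap c x + j` have order dividing `4`, `5` or `6`. -/
def orderBit (c : ℕ) (k : Fin 3) (j : Fin 7) : Bool :=
  decide (∀ x, (shiftedDigitMap c j 1)^[k.val + 4] x = x)

/-- The values `f k j`, read as the binary digits of a natural number. -/
def encodeBits (f : Fin 3 → Fin 7 → Bool) : ℕ :=
  (List.finRange 3).foldl (fun s k => (List.finRange 7).foldl (fun t j => 2 * t + (f k j).toNat) s) 0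

/-- Codes of pairwise inequivalent second generators of the alternating group on `7` letters. -/
def generatorCodes : List ℕ :=
  [369279, 398889, 533751, 266343, 584577, 670713, 401199, 604185, 489729, 334971, 535803,
    670635, 455421, 521649, 662385, 331149, 268443, 624585, 475029, 466005, 658857, 388893,
    526491, 447573, 523749, 663405, 494511, 583947, 503547, 560763, 603555, 307233, 660663,
    671013, 584277, 423591, 349671, 264033, 396837, 201117, 663663, 533505, 616875, 324009,
    578109, 442449, 653961, 659211, 459999, 533331, 657693, 316737, 229971, 217623, 249579,
    338073, 653613, 537189, 402885, 162897, 508515, 662355, 501585, 384435, 357681, 523335,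
    299811, 328671, 312039, 518883, 653787, 211155, 636441, 645723, 631323, 381381, 508707,
    492537, 658191, 424587, 441063, 400239, 194103, 311823, 534009, 385791, 639333, 633591,
    559251, 660051, 577977, 537153, 641799, 644109, 528129, 295953, 402711, 427281, 179991,
    299985, 426993, 506241, 629727, 463995, 662487, 520479, 631149, 518427, 451941, 614511,
    194385, 662985, 433161, 649047, 562611, 620697, 648921, 400821, 525723, 178689, 434841,
    299187, 318801, 561561, 637659, 643155, 562485, 637791]

theorem isGenerating_of_mem : ∀ c ∈ generatorCodes, IsGenerating c := by decide +kernel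

theorem isChain_encodeBits :
    (generatorCodes.map fun c => encodeBits (orderBit c)).IsChain (· < ·) := by decide +kernel

section digitPerm

variable {c : ℕ}

/-- The permutation with underlying function `digitMap c`. -/
noncomputable def digitPerm (hc : IsGenerating c) : Perm (Fin 7) :=
  Equiv.ofBijective (digitMap c) (Finite.injective_iff_bijective.1 fun x y => hc.1 x y)

theorem shift_mul_digitPerm_pow (hc : IsGenerating c) (j : Fin 7) (m : ℕ) :
    ⇑(Equiv.addRight j * digitPerm hc ^ m) = shiftedDigitMap c j m := by
  ext x
  have : ⇑(digitPerm hc) = digitMap c := rfl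
  rw [mul_apply, ← iterate_eq_pow, this]
  rfl

theorem shift_mul_digitPerm_pow_pow (hc : IsGenerating c) (j : Fin 7) (m k : ℕ) :
    ⇑((Equiv.addRight j * digitPerm hc ^ m) ^ k) = (shiftedDigitMap c j m)^[k] := by
  rw [← iterate_eq_pow, shift_mul_digitPerm_pow]

theorem addRight_eq_pow (j : Fin 7) : Equiv.addRight j = Equiv.addRight (1 : Fin 7) ^ j.val := by
  revert j
  decide

theorem sign_addRight_fin_seven (j : Fin 7) : sign (Equiv.addRight j) = 1 := by
  revert j
  decide

theorem sign_digitPerm (hc : IsGenerating c) : sign (digitPerm hc) = 1 := by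
  obtain ⟨j, hj⟩ := hc.2.1
  have h : (Equiv.addRight j * digitPerm hc ^ 1) ^ 5 = 1 := by
    ext1 x
    rw [shift_mul_digitPerm_pow_pow, hj, one_apply]
  have h' := congrArg sign h
  rw [map_pow, Perm.sign_mul, pow_one, sign_addRight_fin_seven, one_mul, Perm.sign_one] at h'
  rcases Int.units_eq_one_or (sign (digitPerm hc)) with h1 | h1
  · exact h1
  · rw [h1] at h'
    exact absurd h' (by decide)

theorem closure_addRight_digitPerm (hc : IsGenerating c) :
    Subgroup.closure {Equiv.addRight (1 : Fin 7), digitPerm hc} = alternatingGroup (Fin 7) := by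
  set G := Subgroup.closure {Equiv.addRight (1 : Fin 7), digitPerm hc}
  have hadd : ∀ j : Fin 7, Equiv.addRight j ∈ G := fun j => by
    rw [addRight_eq_pow]
    exact G.pow_mem (Subgroup.subset_closure (by simp)) _
  apply le_antisymm
  · rw [Subgroup.closure_le]
    rintro _ (rfl | rfl)
    · exact sign_addRight_fin_seven 1
    · exact sign_digitPerm hc
  · obtain ⟨j, m, hjm⟩ := hc.2.2
    have htrans : MulAction.IsPretransitive G (Fin 7) :=
      ⟨fun x y => ⟨⟨Equiv.addRight (y - x), hadd _⟩, add_sub_cancel x y⟩⟩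
    have hprim : MulAction.IsPreprimitive G (Fin 7) :=
      MulAction.IsPreprimitive.of_prime_card (by simpa using Nat.prime_seven)
    refine alternatingGroup_le_of_isPreprimitive_of_isThreeCycle_mem hprim
      (g := (Equiv.addRight j * digitPerm hc ^ m.val) ^ 4) ?_ ?_
    · rw [← card_support_eq_three_iff, support, shift_mul_digitPerm_pow_pow]
      exact hjm
    · exact G.pow_mem (G.mul_mem (hadd j) (G.pow_mem (Subgroup.subset_closure (by simp)) _)) _

theorem orderBit_eq_true_iff (hc : IsGenerating c) (k : Fin 3) (j : Fin 7) :
    orderBit c k j = true ↔ (Equiv.addRight (1 : Fin 7) ^ j.val * digitPerm hc) ^ (k.val + 4) = 1 := by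
  have h := shift_mul_digitPerm_pow_pow hc j 1 (k.val + 4)
  rw [pow_one, addRight_eq_pow] at h
  rw [Equiv.ext_iff, h, orderBit, decide_eq_true_iff]
  rfl

end digitPerm

theorem exists_closure_pair_eq_top_seven :
    ∃ x y : Fin (2 ^ 7) → alternatingGroup (Fin 7), Subgroup.closure {x, y} = ⊤ := by
  have hlength : 2 ^ 7 = generatorCodes.length := by decide +kernel
  let code : Fin (2 ^ 7) → ℕ := fun i => generatorCodes[i.val]'(hlength ▸ i.2)
  have hgen : ∀ i : Fin (2 ^ 7), IsGenerating (code i) := fun i =>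
    isGenerating_of_mem _ (List.getElem_mem _)
  refine exists_closure_pair_eq_top_of_separated (by simp) (fun _ => Equiv.addRight (1 : Fin 7))
    (fun i => digitPerm (hgen i)) (fun i => closure_addRight_digitPerm (hgen i)) fun i j hij => ?_
  have hbits : ∃ k l, orderBit (code i) k l ≠ orderBit (code j) k l := by
    by_contra! hcon
    have hnodup := (List.isChain_iff_pairwise.1 isChain_encodeBits).nodup
    have heq : orderBit (code i) = orderBit (code j) :=
      funext fun k => funext fun l => hcon k l
    refine hij (Fin.ext ((hnodup.getElem_inj_iff (hi := by rw [List.length_map, ← hlength]; exact i.2)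
      (hj := by rw [List.length_map, ← hlength]; exact j.2)).1 ?_))
    rw [List.getElem_map, List.getElem_map]
    exact congrArg encodeBits heq
  obtain ⟨k, l, hkl⟩ := hbits
  refine ⟨((Equiv.addRight (1 : Fin 7), Equiv.addRight (1 : Fin 7)) ^ l.val *
    (digitPerm (hgen i), digitPerm (hgen j))) ^ (k.val + 4), ?_, ?_⟩
  · exact pow_mem (mul_mem (pow_mem (Subgroup.subset_closure (by simp)) _)
      (Subgroup.subset_closure (by simp))) _
  · have hi := orderBit_eq_true_iff (hgen i) k l
    have hj := orderBit_eq_true_iff (hgen j) k l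
    simp only [Prod.pow_mk, Prod.mk_mul_mk, Ne, ← hi, ← hj]
    revert hkl
    generalize orderBit (code i) k l = u
    generalize orderBit (code j) k l = v
    revert u v
    decide

end

/-- For every `n ≥ 7`, the direct product `A_n^{2^n}` of `2^n` copies of the alternating
group on `n` letters is generated by `2` elements. -/
theorem alternating_power_two_generated (n : ℕ) (hn : 7 ≤ n) :
    ∃ g h : (Fin (2 ^ n) → ↥(alternatingGroup (Fin n))),
      Subgroup.closure {g, h} = ⊤ := by
  rcases (by lia : n = 7 ∨ n = 8 ∨ n = 9 ∨ 10 ≤ n) with rfl | rfl | rfl | h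
  · exact exists_closure_pair_eq_top_seven
  · exact exists_closure_pair_eq_top_eight
  · exact exists_closure_pair_eq_top_nine
  · exact exists_closure_pair_eq_top_of_ten_le h
end

section
/- The finite group A_6^{64}, the direct product of 64 = 2^6 copies of the alternating group A_6 on 6 letters, is not generated by 2 elements. -/
open Equiv
open scoped Pointwise

namespace AlternatingSix

/-- The `1`-factorization of the complete graph on `{0, …, 5}` in which, viewing `5` as the point
at infinity of the projective line over `ZMod 5`, the edge `{x, y}` has color `(x + y) / 2` and the
edge `{x, 5}` has color `x`. Loops receive the extra color `5`. -/
def edgeColor (x y : ℕ) : ℕ :=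
  if x = y then 5 else if x = 5 then y else if y = 5 then x else 3 * (x + y) % 5

theorem edgeColor_lt (x y : Fin 6) : edgeColor x y < 6 := by
  revert x y; decide

theorem edgeColor_injective (x y z : Fin 6) (h : edgeColor x y = edgeColor x z) : y = z := by
  revert x y z; decide

theorem edgeColor_five_edgeColor (x y : Fin 6) : edgeColor 5 (edgeColor x y) = edgeColor x y := by
  revert x y; decide

/-- The stabilizer of the `1`-factorization `edgeColor`, a copy of `PGL(2, 5)` acting transitively
on six letters. -/
def colorStabilizer : Subgroup (Perm (Fin 6)) where
  carrier := {g | ∀ x y z w, edgeColor (g x) (g y) = edgeColor (g z) (g w) ↔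
    edgeColor x y = edgeColor z w}
  one_mem' _ _ _ _ := Iff.rfl
  mul_mem' ha hb _ _ _ _ := (ha _ _ _ _).trans (hb _ _ _ _)
  inv_mem' {g} hg x y z w := by
    simpa using (hg (g⁻¹ x) (g⁻¹ y) (g⁻¹ z) (g⁻¹ w)).symm

theorem mem_colorStabilizer_iff (g : Perm (Fin 6)) : g ∈ colorStabilizer ↔
    ∀ x y, edgeColor (g x) (g y) = edgeColor (g 5) (g ⟨edgeColor x y, edgeColor_lt x y⟩) := by
  refine ⟨fun hg x y ↦ (hg _ _ _ _).2 (edgeColor_five_edgeColor x y).symm, fun hg x y z w ↦ ?_⟩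
  rw [hg x y, hg z w]
  refine ⟨fun h ↦ ?_, fun h ↦ by simp only [h]⟩
  simpa using g.injective (edgeColor_injective _ _ _ h)

instance : DecidablePred (· ∈ colorStabilizer) := fun g ↦
  decidable_of_iff' _ (mem_colorStabilizer_iff g)

/-- The transpositions `(i 5)` represent the cosets of `colorStabilizer`. -/
def coset (i : Fin 6) : Perm (Fin 6) ⧸ colorStabilizer := (swap i 5 : Perm (Fin 6))

theorem coset_bijective : Function.Bijective coset := by
  constructor
  · have key : ∀ i j : Fin 6, (swap i 5)⁻¹ * swap j 5 ∈ colorStabilizer → i = j := by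
      decide +kernel
    exact fun i j h ↦ key i j (QuotientGroup.eq.1 h)
  · intro q
    obtain ⟨g, rfl⟩ := QuotientGroup.mk_surjective q
    induction g using Perm.swap_induction_on with
    | one => exact ⟨5, by simp [coset]; rfl⟩
    | swap_mul f x y _ ih =>
      obtain ⟨i, hi⟩ := ih
      have key : ∀ x y i : Fin 6, ∃ j : Fin 6,
          (swap j 5)⁻¹ * (swap x y * swap i 5) ∈ colorStabilizer := by decide +kernel
      obtain ⟨j, hj⟩ := key x y i
      refine ⟨j, (QuotientGroup.eq.2 hj).trans ?_⟩
      exact congrArg (swap x y • ·) hi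

/-- The exotic endomorphism of the symmetric group on six letters, given by its action on the
cosets of `colorStabilizer`. -/
noncomputable def exoticHom : Perm (Fin 6) →* Perm (Fin 6) :=
  (Equiv.ofBijective coset coset_bijective).symm.permCongrHom.toMonoidHom.comp
    (MulAction.toPermHom (Perm (Fin 6)) (Perm (Fin 6) ⧸ colorStabilizer))

theorem exoticHom_apply_eq_self_iff (g : Perm (Fin 6)) (i : Fin 6) :
    exoticHom g i = i ↔ (swap i 5)⁻¹ * g * swap i 5 ∈ colorStabilizer := by
  have h : exoticHom g i = (Equiv.ofBijective coset coset_bijective).symm (g • coset i) := rfl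
  rw [h, Equiv.symm_apply_eq, eq_comm, mul_assoc]
  exact QuotientGroup.eq

theorem exoticHom_mem_alternatingGroup (a : alternatingGroup (Fin 6)) :
    exoticHom a ∈ alternatingGroup (Fin 6) := by
  have h := Abelianization.commutator_subset_ker (Perm.sign.comp exoticHom)
  rw [alternatingGroup.commutator_perm_eq (by simp)] at h
  exact h a.2

/-- A three-cycle in the alternating group on six letters. -/
def threeCycle : alternatingGroup (Fin 6) := 
  ⟨swap 0 1 * swap 1 2, Perm.mem_alternatingGroup.2 (by decide)⟩

theorem exoticHom_threeCycle_ne (i : Fin 6) : exoticHom threeCycle i ≠ i := by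
  rw [Ne, exoticHom_apply_eq_self_iff]
  revert i
  decide +kernel

/-- The restriction of `exoticHom` to the alternating group. -/
noncomputable def exoticEnd : alternatingGroup (Fin 6) →* alternatingGroup (Fin 6) :=
  (exoticHom.comp (alternatingGroup (Fin 6)).subtype).codRestrict _ exoticHom_mem_alternatingGroup

theorem exoticEnd_injective : Function.Injective exoticEnd := by
  have : IsSimpleGroup (alternatingGroup (Fin 6)) := alternatingGroup.isSimpleGroup (by simp)
  rw [← MonoidHom.ker_eq_bot_iff]
  refine exoticEnd.normal_ker.eq_bot_or_eq_top.resolve_right fun h ↦ ?_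
  have hmem : threeCycle ∈ exoticEnd.ker := h ▸ Subgroup.mem_top _
  exact exoticHom_threeCycle_ne 0
    (congrArg (fun a : alternatingGroup (Fin 6) ↦ (a : Perm (Fin 6)) 0) (MonoidHom.mem_ker.1 hmem))

/-- An automorphism of the alternating group on six letters that is not induced by the symmetric
group. -/
noncomputable def exoticAut : MulAut (alternatingGroup (Fin 6)) :=
  MulEquiv.ofBijective exoticEnd (Finite.injective_iff_bijective.1 exoticEnd_injective)

theorem conjNormal_injective :
    Function.Injective (MulAut.conjNormal (H := alternatingGroup (Fin 6))) := by
  rw [injective_iff_map_eq_one]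
  intro s hs
  have comm (a : alternatingGroup (Fin 6)) : s * a = a * s := by
    rw [← mul_inv_eq_iff_eq_mul, ← MulAut.conjNormal_apply, hs, MulAut.one_apply]
  have key : ∀ s : Perm (Fin 6), s * threeCycle = threeCycle * s →
      s * (swap 2 3 * swap 3 4 * (swap 4 5 * swap 5 0)) =
        (swap 2 3 * swap 3 4 * (swap 4 5 * swap 5 0)) * s → s = 1 := by decide +kernel
  exact key s (comm threeCycle) (comm ⟨_, Perm.mem_alternatingGroup.2 (by decide)⟩)

theorem conjNormal_mul_exoticAut_ne (s t : Perm (Fin 6)) :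
    MulAut.conjNormal (H := alternatingGroup (Fin 6)) s * exoticAut ≠ MulAut.conjNormal t := by
  intro h
  have hval : exoticAut = MulAut.conjNormal (s⁻¹ * t) := by
    rw [map_mul, ← h, map_inv, inv_mul_cancel_left]
  have h3 : exoticHom threeCycle = (s⁻¹ * t) * threeCycle * (s⁻¹ * t)⁻¹ := by
    rw [← MulAut.conjNormal_apply, ← hval]
    rfl
  apply exoticHom_threeCycle_ne ((s⁻¹ * t) 3)
  rw [h3, Perm.mul_apply, Perm.mul_apply, ← Perm.mul_apply _ (s⁻¹ * t),
    inv_mul_cancel, Perm.one_apply]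
  rfl

theorem le_card_mulAut : 1440 ≤ Nat.card (MulAut (alternatingGroup (Fin 6))) := by
  let f : Perm (Fin 6) × Bool → MulAut (alternatingGroup (Fin 6)) :=
    fun p ↦ MulAut.conjNormal p.1 * if p.2 then exoticAut else 1
  have hf : Function.Injective f := by
    rintro ⟨s, _ | _⟩ ⟨t, _ | _⟩ h
    · simpa [f, conjNormal_injective.eq_iff] using h
    · exact absurd h.symm (by simpa [f] using conjNormal_mul_exoticAut_ne t s)
    · exact absurd h (by simpa [f] using conjNormal_mul_exoticAut_ne s t)
    · simpa [f, conjNormal_injective.eq_iff] using h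
  simpa [Nat.card_prod, Fintype.card_perm, Nat.factorial] using
    Nat.card_le_card_of_injective f hf

/-- The values of a permutation of six letters, as the digits of a number in base `8`. -/
def code (g : Perm (Fin 6)) : ℕ := ∑ i : Fin 6, (g i : ℕ) * 8 ^ (i : ℕ)

/-- The `i`-th digit of `n` in base `8`. -/
def digit (n i : ℕ) : ℕ := n / 8 ^ i % 8

theorem digit_code (g : Perm (Fin 6)) (i : Fin 6) : digit (code g) i = g i := by
  have h (j : Fin 6) := (g j).isLt
  have h0 := h 0
  have h1 := h 1
  have h2 := h 2
  have h3 := h 3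
  have h4 := h 4
  have h5 := h 5
  clear h
  fin_cases i <;> simp [digit, code, Fin.sum_univ_succ] <;> omega

/-- The transposition `(i 5)` on natural numbers. -/
def swapNat (i x : ℕ) : ℕ := if x = i then 5 else if x = 5 then i else x

theorem swapNat_val (i x : Fin 6) : swapNat i x = swap i 5 x := by
  revert i x; decide

/-- Whether the map `u` on `{0, …, 5}` preserves the `1`-factorization `edgeColor`. -/
def preservesColoring (u : ℕ → ℕ) : Bool :=
  (List.range 6).all fun x ↦ (List.range 6).all fun y ↦
    edgeColor (u x) (u y) == edgeColor (u 5) (u (edgeColor x y))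

theorem mem_colorStabilizer_of_preservesColoring {u : ℕ → ℕ} {g : Perm (Fin 6)}
    (hu : ∀ x : Fin 6, u x = g x) (h : preservesColoring u = true) : g ∈ colorStabilizer := by
  rw [mem_colorStabilizer_iff]
  intro x y
  simp only [preservesColoring, List.all_eq_true, List.mem_range, beq_iff_eq] at h
  rw [← hu, ← hu, ← hu, ← hu]
  exact h x x.2 y y.2

/-- Eighteen subgroups of the symmetric group on six letters: six stabilizers of points, six
stabilizers of pairs, and six stabilizers of `1`-factorizations. -/
def testSubgroup (b : Fin 18) : Subgroup (Perm (Fin 6)) :=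
  match b.1 / 6 with
  | 0 => MulAction.stabilizer _ (Fin.ofNat 6 b)
  | 1 => MulAction.stabilizer _ ({Fin.ofNat 6 b, Fin.ofNat 6 (b + 1)} : Finset (Fin 6))
  | _ => colorStabilizer.map (MulAut.conj (swap (Fin.ofNat 6 b) 5)).toMonoidHom

/-- Whether the permutation with code `n` lies in `testSubgroup b`. -/
def fixes (n b : ℕ) : Bool :=
  match b / 6 with
  | 0 => digit n (b % 6) == b % 6
  | 1 => (digit n (b % 6) == b % 6 && digit n ((b + 1) % 6) == (b + 1) % 6) ||
      (digit n (b % 6) == (b + 1) % 6 && digit n ((b + 1) % 6) == b % 6)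
  | _ => preservesColoring fun x ↦ swapNat (b % 6) (digit n (swapNat (b % 6) x))

theorem mem_testSubgroup {g : Perm (Fin 6)} {b : Fin 18} (h : fixes (code g) b = true) :
    g ∈ testSubgroup b := by
  unfold fixes at h
  unfold testSubgroup
  have hd (i : ℕ) : digit (code g) (i % 6) = g (Fin.ofNat 6 i) := digit_code g (Fin.ofNat 6 i)
  have heq (i j : ℕ) : (g (Fin.ofNat 6 i) : ℕ) = j % 6 ↔ g (Fin.ofNat 6 i) = Fin.ofNat 6 j :=
    (Fin.ext_iff (b := Fin.ofNat 6 j)).symm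
  split at h <;> rename_i hb
  · simp only [hd, heq, beq_iff_eq] at h
    exact MulAction.mem_stabilizer_iff.2 h
  · simp only [hd, heq, Bool.or_eq_true, Bool.and_eq_true, beq_iff_eq] at h
    simp only [MulAction.mem_stabilizer_iff, Finset.smul_finset_insert,
      Finset.smul_finset_singleton, Perm.smul_def]
    rcases h with ⟨h, hval⟩ | ⟨h, hval⟩ <;> rw [h, hval]
    exact Finset.pair_comm _ _
  · have hmem := mem_colorStabilizer_of_preservesColoring
      (g := swap (Fin.ofNat 6 b) 5 * g * swap (Fin.ofNat 6 b) 5) (fun x ↦ ?_) h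
    · exact ⟨_, hmem, by simp [mul_assoc]⟩
    · change swapNat (Fin.ofNat 6 b) (digit _ (swapNat (Fin.ofNat 6 b) x)) = _
      rw [swapNat_val, digit_code, swapNat_val]
      rfl

/-- An even permutation that lies in none of the subgroups `testSubgroup`. -/
def witness : alternatingGroup (Fin 6) :=
  ⟨swap 0 3 * (swap 1 2 * swap 2 4 * swap 4 5), Perm.mem_alternatingGroup.2 (by decide)⟩

theorem witness_notMem (b : Fin 18) : (witness : Perm (Fin 6)) ∉ testSubgroup b := by
  have hpoint : ∀ i : Fin 6, (witness : Perm (Fin 6)) i ≠ i := by decide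
  have hpair : ∀ b : Fin 18, ({(witness : Perm (Fin 6)) (Fin.ofNat 6 b),
      (witness : Perm (Fin 6)) (Fin.ofNat 6 (b + 1))} : Finset (Fin 6)) ≠
        {Fin.ofNat 6 b, Fin.ofNat 6 (b + 1)} := by decide
  have hcolor : ∀ i : Fin 6, (swap i 5)⁻¹ * witness * swap i 5 ∉ colorStabilizer := by
    decide +kernel
  unfold testSubgroup
  split
  · exact hpoint _
  · simpa only [MulAction.mem_stabilizer_iff, Finset.smul_finset_insert,
      Finset.smul_finset_singleton, Perm.smul_def] using hpair b
  · rintro ⟨x, hx, hconj⟩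
    apply hcolor (Fin.ofNat 6 b)
    rw [← hconj]
    simpa [mul_assoc] using hx

/-- The set of those `b < 18` for which the permutation with code `n` lies in `testSubgroup b`,
in binary. -/
def mask (n : ℕ) : ℕ := Nat.ofBits fun b : Fin 18 ↦ fixes n b

theorem closure_ne_top_of_mask {g h : alternatingGroup (Fin 6)}
    (hgh : mask (code g) &&& mask (code h) ≠ 0) : Subgroup.closure {g, h} ≠ ⊤ := by
  intro htop
  obtain ⟨b, hb⟩ := Nat.exists_testBit_of_ne_zero hgh
  rw [Nat.testBit_and, Bool.and_eq_true] at hb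
  have hlt : b < 18 := by
    by_contra hlt
    simp [mask, Nat.testBit_ofBits_ge _ _ (not_lt.1 hlt)] at hb
  simp only [mask, Nat.testBit_ofBits_lt _ _ hlt] at hb
  have hle : Subgroup.closure {g, h} ≤
      (testSubgroup ⟨b, hlt⟩).comap (alternatingGroup (Fin 6)).subtype := by
    rw [Subgroup.closure_le]
    rintro _ (rfl | rfl)
    exacts [mem_testSubgroup hb.1, mem_testSubgroup hb.2]
  exact witness_notMem ⟨b, hlt⟩ (hle (htop ▸ Subgroup.mem_top witness))

/-- A list of the even permutations of six letters. -/
@[irreducible] def evenPerms : List (Perm (Fin 6)) :=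
  (permsOfList (List.finRange 6)).filter fun g ↦ Perm.sign g = 1

theorem mem_evenPerms (g : alternatingGroup (Fin 6)) : (g : Perm (Fin 6)) ∈ evenPerms := by
  simpa [evenPerms, mem_permsOfList_iff] using Perm.mem_alternatingGroup.1 g.2

/-- Application `k n`, arranged so that reduction evaluates `n` to a literal first. -/
def withNat {α : Type*} (n : ℕ) (k : ℕ → α) : α := Nat.rec (k 0) (fun m _ ↦ k (Nat.succ m)) n

theorem withNat_eq {α : Type*} (n : ℕ) (k : ℕ → α) : withNat n k = k n := by
  cases n <;> rfl

/-- Application `k l`, arranged so that reduction evaluates the entries of `l` to literals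
first. -/
def withList {α : Type*} (l : List ℕ) : (List ℕ → α) → α :=
  List.rec (fun k ↦ k []) (fun a _ ih k ↦ withNat a fun a ↦ ih fun l ↦ k (a :: l)) l

theorem withList_eq {α : Type*} (l : List ℕ) (k : List ℕ → α) : withList l k = k l := by
  induction l generalizing k with
  | nil => rfl
  | cons a l ih => exact (withNat_eq a fun a ↦ withList l fun l ↦ k (a :: l)).trans (ih _)

/-- The number of pairs of entries of `l` without common binary digits `1`. -/
def disjointPairs (l : List ℕ) : ℕ :=
  (l.map fun a ↦ l.countP fun b ↦ Nat.beq (Nat.land a b) 0).sum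

theorem length_filter_product {α : Type*} (l : List α) (m : α → ℕ) :
    ((l ×ˢ l).filter fun p ↦ Nat.beq (Nat.land (m p.1) (m p.2)) 0).length =
      disjointPairs (l.map m) := by
  simp only [← List.countP_eq_length_filter, disjointPairs, SProd.sprod, List.product,
    List.countP_flatMap, List.map_map, List.countP_map, Function.comp_def]

theorem disjointPairs_evenPerms_le :
    disjointPairs (evenPerms.map fun g ↦ mask (code g)) ≤ 91596 := by
  have key : (withList (evenPerms.map code) fun l ↦
      withList (l.map mask) disjointPairs) ≤ 91596 := by
    decide +kernel
  simpa only [withList_eq, List.map_map, Function.comp_def] using key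

theorem card_generatingPairs_le :
    Nat.card {p : alternatingGroup (Fin 6) × alternatingGroup (Fin 6) //
      Subgroup.closure {p.1, p.2} = ⊤} ≤ 91596 := by
  let L := (evenPerms ×ˢ evenPerms).filter fun p ↦
    Nat.beq (Nat.land (mask (code p.1)) (mask (code p.2))) 0
  have hL : L.length ≤ 91596 :=
    (length_filter_product evenPerms fun g ↦ mask (code g)).trans_le disjointPairs_evenPerms_le
  let f : {p : alternatingGroup (Fin 6) × alternatingGroup (Fin 6) //
      Subgroup.closure {p.1, p.2} = ⊤} → L.toFinset := fun p ↦ ⟨(p.1.1, p.1.2), by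
    simp only [L, List.mem_toFinset, List.mem_filter, List.mem_product, Nat.beq_eq]
    refine ⟨⟨mem_evenPerms _, mem_evenPerms _⟩, ?_⟩
    by_contra h
    exact closure_ne_top_of_mask h p.2⟩
  have hf : Function.Injective f := by
    rintro ⟨⟨a, b⟩, _⟩ ⟨⟨c, d⟩, _⟩ h
    have hval := Prod.ext_iff.1 (Subtype.ext_iff.1 h)
    exact Subtype.ext (Prod.ext (Subtype.ext hval.1) (Subtype.ext hval.2))
  calc _ ≤ Nat.card L.toFinset := Nat.card_le_card_of_injective f hf
    _ ≤ L.length := by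
      rw [Nat.card_eq_fintype_card, Fintype.card_coe]
      exact L.toFinset_card_le
    _ ≤ 91596 := hL

end AlternatingSix

section Power

variable {G : Type*} [Group G] {ι : Type*} {g h : ι → G}

theorem Subgroup.closure_apply_eq_top_of_closure_eq_top (hgh : closure {g, h} = ⊤) (i : ι) :
    closure {g i, h i} = ⊤ := by
  have := congrArg (Subgroup.map (Pi.evalMonoidHom (fun _ : ι ↦ G) i)) hgh
  rwa [MonoidHom.map_closure, Set.image_pair, ← MonoidHom.range_eq_map,
    MonoidHom.range_eq_top.2 (Function.surjective_eval i)] at this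

theorem Subgroup.closure_ne_top_of_mulAut [Nontrivial G] {i j : ι} (hij : i ≠ j) (α : MulAut G)
    (hg : α (g i) = g j) (hh : α (h i) = h j) : closure {g, h} ≠ ⊤ := by
  classical
  intro htop
  have hle : closure {g, h} ≤ MonoidHom.eqLocus
      (α.toMonoidHom.comp (Pi.evalMonoidHom (fun _ : ι ↦ G) i))
      (Pi.evalMonoidHom (fun _ : ι ↦ G) j) := by
    rw [closure_le]
    rintro _ (rfl | rfl)
    exacts [hg, hh]
  obtain ⟨x, hx⟩ := exists_ne (1 : G)
  have := hle (htop ▸ Subgroup.mem_top (Pi.mulSingle j x))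
  apply hx
  simpa [MonoidHom.eqLocus, hij] using this.symm

theorem Subgroup.card_mul_card_mulAut_le_card_generatingPairs [Finite G] [Nontrivial G]
    (hgh : closure {g, h} = ⊤) :
    Nat.card ι * Nat.card (MulAut G) ≤ Nat.card {p : G × G // closure {p.1, p.2} = ⊤} := by
  have hgen := closure_apply_eq_top_of_closure_eq_top hgh
  let f : ι × MulAut G → {p : G × G // closure {p.1, p.2} = ⊤} := fun p ↦
    ⟨(p.2 (g p.1), p.2 (h p.1)), by
      have := congrArg (Subgroup.map p.2.toMonoidHom) (hgen p.1)
      rwa [MonoidHom.map_closure, Set.image_pair, ← MonoidHom.range_eq_map,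
        MonoidHom.range_eq_top.2 p.2.surjective] at this⟩
  have hf : Function.Injective f := by
    rintro ⟨i, α⟩ ⟨j, β⟩ hfe
    have hg : α (g i) = β (g j) := congrArg (fun q ↦ q.1.1) hfe
    have hh : α (h i) = β (h j) := congrArg (fun q ↦ q.1.2) hfe
    obtain rfl : i = j := by
      by_contra hij
      refine closure_ne_top_of_mulAut hij (β⁻¹ * α) ?_ ?_ hgh
      · simp [hg]
      · simp [hh]
    have : α.toMonoidHom = β.toMonoidHom := by
      refine MonoidHom.eq_of_eqOn_dense (hgen i) ?_
      rintro _ (rfl | rfl)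
      exacts [hg, hh]
    rw [Prod.mk.injEq]
    exact ⟨rfl, MulEquiv.toMonoidHom_injective this⟩
  simpa only [Nat.card_prod] using Nat.card_le_card_of_injective f hf

end Power

/-- The direct product `A_6^{64}` of `64 = 2^6` copies of the alternating group on `6`
letters is not generated by `2` elements. -/
theorem alternating_six_power_not_two_generated :
    ¬ ∃ g h : (Fin 64 → ↥(alternatingGroup (Fin 6))),
        Subgroup.closure {g, h} = ⊤ := by
  rintro ⟨g, h, hgh⟩
  have : Nontrivial (alternatingGroup (Fin 6)) := alternatingGroup.nontrivial_of_three_le_card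
    (by simp)
  have h₁ := Subgroup.card_mul_card_mulAut_le_card_generatingPairs hgh
  have h₂ := AlternatingSix.card_generatingPairs_le
  have h₃ := AlternatingSix.le_card_mulAut
  rw [Nat.card_fin] at h₁
  omega
end

section
/- Let S be a nontrivial finite group, let p be a prime not dividing the order of S, and let G = S^ℕ be the product of countably infinitely many copies of S with the product topology (each factor discrete). Then there are infinitely many isomorphism classes of finite simple G-modules which are elementary abelian p-groups of cardinality at most p^{|S|}; in particular, the number of isomorphism classes of finite simple G-modules of cardinality n is not bounded by any polynomial in n. -/
/-- A carrier type of cardinality `n` with no pre-existing algebraic instances. -/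
def Carrier (n : ℕ) : Type := Fin n

/-- A finite simple `G`-module of cardinality `n`: an abelian group structure on a carrier of
cardinality `n` (necessarily `n ≥ 2` since the module is nonzero), with a continuous
`G`-action by additive automorphisms (the carrier being discrete) admitting no nontrivial
proper `G`-invariant subgroups.  These are exactly the irreducible `Ẑ⟦G⟧`-modules of
cardinality `n`. -/
structure SimpleGMod (G : Type*) [Group G] [TopologicalSpace G] (n : ℕ) where
  two_le : 2 ≤ n
  add : AddCommGroup (Carrier n)
  act : letI := add; DistribMulAction G (Carrier n)
  cont : letI := add; letI := act; letI : TopologicalSpace (Carrier n) := ⊥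
    Continuous fun q : G × Carrier n => q.1 • q.2
  simple : letI := add; letI := act;
    ∀ N : AddSubgroup (Carrier n), (∀ (g : G) x, x ∈ N → g • x ∈ N) → N = ⊥ ∨ N = ⊤

/-- The addition of a finite simple `G`-module. -/
def SimpleGMod.addOp {G : Type*} [Group G] [TopologicalSpace G] {n : ℕ}
    (M : SimpleGMod G n) (x y : Carrier n) : Carrier n :=
  letI := M.add; x + y

/-- The `G`-action of a finite simple `G`-module. -/
def SimpleGMod.smulOp {G : Type*} [Group G] [TopologicalSpace G] {n : ℕ}
    (M : SimpleGMod G n) (g : G) (x : Carrier n) : Carrier n :=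
  letI := M.add; letI := M.act; g • x

/-- Isomorphism of finite simple `G`-modules with the same carrier: an additive,
`G`-equivariant bijection. -/
def gmodIso {G : Type*} [Group G] [TopologicalSpace G] {n : ℕ} (M N : SimpleGMod G n) : Prop :=
  ∃ e : Carrier n ≃ Carrier n,
    (∀ x y, e (M.addOp x y) = N.addOp (e x) (e y)) ∧
    ∀ (g : G) x, e (M.smulOp g x) = N.smulOp g (e x)

/-- A profinite group `G` has UBERG if the number of isomorphism classes of finite simple
`G`-modules of cardinality `n` is bounded by a polynomial in `n` (in particular, for each
`n` there are only finitely many such isomorphism classes). -/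
def HasUBERG (G : Type*) [Group G] [TopologicalSpace G] : Prop :=
  ∃ c : ℕ, ∀ n : ℕ, Finite (Quot (gmodIso (G := G) (n := n))) ∧
    Nat.card (Quot (gmodIso (G := G) (n := n))) ≤ n ^ c

/-- The finite simple `G`-modules of cardinality at most `b` which are elementary abelian
`p`-groups (every element is killed by `p`). -/
def ElemPMod (G : Type*) [Group G] [TopologicalSpace G] (p b : ℕ) : Type _ :=
  {X : Σ n : ℕ, SimpleGMod G n //
    X.1 ≤ b ∧ ∀ x : Carrier X.1, (letI := X.2.add; p • x = 0)}

/-- Isomorphism of such modules (of possibly different cardinalities). -/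
def elemIso {G : Type*} [Group G] [TopologicalSpace G] {p b : ℕ}
    (X Y : ElemPMod G p b) : Prop :=
  ∃ h : X.1.1 = Y.1.1, gmodIso (h ▸ X.1.2) Y.1.2

/-- The kernel of the action of `G` on a finite simple `G`-module. -/
def SimpleGMod.kernel {G : Type*} [Group G] [TopologicalSpace G] {n : ℕ}
    (M : SimpleGMod G n) : Set G :=
  {g | ∀ x, M.smulOp g x = x}

theorem gmodIso.kernel_eq {G : Type*} [Group G] [TopologicalSpace G] {n : ℕ}
    {M N : SimpleGMod G n} (h : gmodIso M N) : M.kernel = N.kernel := by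
  obtain ⟨e, -, he⟩ := h
  ext g
  constructor
  · intro hg x
    have := he g (e.symm x)
    rw [hg, e.apply_symm_apply] at this
    exact this.symm
  · intro hg x
    apply e.injective
    rw [he, hg]

theorem elemIso.kernel_eq {G : Type*} [Group G] [TopologicalSpace G] {p b : ℕ}
    {X Y : ElemPMod G p b} (h : elemIso X Y) : X.1.2.kernel = Y.1.2.kernel := by
  obtain ⟨⟨n, M⟩, hX⟩ := X
  obtain ⟨⟨m, N⟩, hY⟩ := Y
  obtain ⟨h, hi⟩ := h
  dsimp only at h
  subst h
  exact gmodIso.kernel_eq hi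

/-- The finite simple `G`-module obtained by inflating a finite simple `S`-module `V` along a
continuous surjection `f : G → S` onto a discrete group, and transporting it to `Carrier n`. -/
def SimpleGMod.inflate {G S V : Type*} [Group G] [TopologicalSpace G] [Group S]
    [TopologicalSpace S] [DiscreteTopology S] [AddCommGroup V] [DistribMulAction S V]
    (hV : ∀ N : AddSubgroup V, (∀ (s : S) x, x ∈ N → s • x ∈ N) → N = ⊥ ∨ N = ⊤)
    (f : G →* S) (hf : Continuous f) (hsurj : Function.Surjective f)
    {n : ℕ} (hn : 2 ≤ n) (e : Carrier n ≃ V) : SimpleGMod G n :=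
  letI : AddCommGroup (Carrier n) := e.addCommGroup
  letI : DistribMulAction G (Carrier n) :=
    { smul := fun g x => e.symm (f g • e x)
      one_smul := fun x => show e.symm (f 1 • e x) = x by simp
      mul_smul := fun g h x => show e.symm (f (g * h) • e x) =
        e.symm (f g • e (e.symm (f h • e x))) by simp [mul_smul]
      smul_zero := fun g => show e.symm (f g • e (e.symm 0)) = e.symm 0 by simp
      smul_add := fun g x y => show e.symm (f g • e (e.symm (e x + e y))) =
        e.symm (e (e.symm (f g • e x)) + e (e.symm (f g • e y))) by simp }
  { two_le := hn
    add := inferInstance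
    act := inferInstance
    cont := by
      let : TopologicalSpace (Carrier n) := ⊥
      have : DiscreteTopology (Carrier n) := ⟨rfl⟩
      exact (continuous_of_discreteTopology
        (f := fun q : S × Carrier n => e.symm (q.1 • e q.2))).comp
          (hf.prodMap continuous_id)
    simple := by
      intro N hN
      have key := hV (N.map (e.addEquiv : Carrier n →+ V)) (by
        rintro s _ ⟨x, hx, rfl⟩
        obtain ⟨g, rfl⟩ := hsurj s
        exact ⟨g • x, hN g x hx, e.apply_symm_apply _⟩)
      refine key.imp (fun h => ?_) fun h => ?_
      · exact (AddSubgroup.map_eq_bot_iff_of_injective N e.injective).1 h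
      · rw [AddSubgroup.eq_top_iff']
        intro x
        have hx : e x ∈ N.map (e.addEquiv : Carrier n →+ V) := h ▸ AddSubgroup.mem_top _
        obtain ⟨y, hy, hxy⟩ := hx
        rwa [← e.injective hxy] }

/-- A nontrivial finite group of order prime to `p` has a nontrivial simple module inside its
regular representation over `ZMod p`. -/
theorem exists_simple_module_nontrivial_action.{u} (S : Type u) [Group S] [Finite S] [Nontrivial S]
    (p : ℕ) (hp : p.Prime) (hdvd : ¬ p ∣ Nat.card S) :
    ∃ (V : Type u) (_ : AddCommGroup V) (_ : DistribMulAction S V),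
      Finite V ∧ Nontrivial V ∧ Nat.card V ≤ p ^ Nat.card S ∧ (∀ x : V, p • x = 0) ∧
      (∀ N : AddSubgroup V, (∀ (s : S) x, x ∈ N → s • x ∈ N) → N = ⊥ ∨ N = ⊤) ∧
      ∃ (s : S) (x : V), s • x ≠ x := by
  have : Fact p.Prime := ⟨hp⟩
  have : NeZero (Nat.card S : ZMod p) := ⟨by rwa [Ne, ZMod.natCast_eq_zero_iff]⟩
  let A := MonoidAlgebra (ZMod p) S
  have hcard : Nat.card A = p ^ Nat.card S := by
    have e : A ≃ (S → ZMod p) :=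
      (MonoidAlgebra.coeffEquiv (R := ZMod p) (M := S)).trans Finsupp.equivFunOnFinite
    rw [Nat.card_congr e, Nat.card_fun, Nat.card_zmod]
  have : Finite A := Nat.finite_of_card_ne_zero (by rw [hcard]; exact (pow_pos hp.pos _).ne')
  obtain ⟨W, hW, s, x, hx, hsx⟩ : ∃ W : Submodule A A, IsSimpleModule A W ∧
      ∃ (s : S) (x : A), x ∈ W ∧ MonoidAlgebra.of (ZMod p) S s * x ≠ x := by
    by_contra! hcon
    obtain ⟨s, hs⟩ := exists_ne (1 : S)
    let a : A := MonoidAlgebra.of (ZMod p) S s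
    let K : Submodule A A :=
      sSup {W : Submodule A A | IsSimpleModule A W}
    have hK : K = ⊤ := IsSemisimpleModule.sSup_simples_eq_top A A
    have h1 : (1 : A) ∈ K := hK ▸ Submodule.mem_top
    have hfix : ∀ y ∈ K, a * y = y := by
      intro y hy
      simp only [K, sSup_eq_iSup] at hy
      refine Submodule.iSup_induction' (fun W : Submodule A A => ⨆ _ : IsSimpleModule A W, W)
        (motive := fun y _ => a * y = y) ?_ (mul_zero a) ?_ hy
      · intro W y hy
        by_cases hW : IsSimpleModule A W
        · simp only [hW, iSup_pos] at hy
          exact hcon W hW s y hy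
        · simp only [hW, iSup_neg, not_false_eq_true, Submodule.mem_bot] at hy
          simp [hy]
      · intro y z _ _ hy hz
        rw [mul_add, hy, hz]
    have := hfix 1 h1
    rw [mul_one] at this
    exact hs (MonoidAlgebra.of_injective (this.trans (map_one _).symm))
  let act : DistribMulAction S W := DistribMulAction.compHom W (MonoidAlgebra.of (ZMod p) S)
  have hsmul : ∀ (s : S) (w : W), s • w = MonoidAlgebra.of (ZMod p) S s • w := fun _ _ => rfl
  refine ⟨W, inferInstance, act, inferInstance, IsSimpleModule.nontrivial A W, ?_, ?_, ?_, s,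
    ⟨x, hx⟩, fun h => hsx (congrArg Subtype.val h)⟩
  · rw [← hcard]
    exact Nat.card_le_card_of_injective _ Subtype.val_injective
  · intro y
    rw [← Nat.cast_smul_eq_nsmul (ZMod p), CharP.cast_eq_zero, zero_smul]
  · intro N hN
    have hNsmul : ∀ (a : A) (y : W), y ∈ N → a • y ∈ N := by
      intro a y hy
      induction a using MonoidAlgebra.induction_on with
      | of g => exact hN g y hy
      | add a b ha hb => rw [add_smul]; exact N.add_mem ha hb
      | smul r a ha =>
        obtain ⟨m, rfl⟩ := ZMod.natCast_zmod_surjective r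
        rw [Nat.cast_smul_eq_nsmul, smul_assoc]
        exact N.nsmul_mem ha m
    let N' : Submodule A W := { N with smul_mem' := fun a y hy => hNsmul a y hy }
    refine (eq_bot_or_eq_top N').imp (fun h => ?_) fun h => ?_
    · exact congrArg Submodule.toAddSubgroup h
    · exact congrArg Submodule.toAddSubgroup h

/-- Let `S` be a nontrivial finite (discrete) group and `p` a prime not dividing `|S|`, and
let `G = S^ℕ` with the product topology.  Then there are infinitely many isomorphism
classes of finite simple `G`-modules which are elementary abelian `p`-groups of
cardinality at most `p^|S|`; in particular the number of isomorphism classes of finite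
simple `G`-modules of cardinality `n` is not polynomially bounded in `n`, i.e. `G` does
not have UBERG. -/
theorem prod_infinitely_many_simple_modules (S : Type*) [Group S] [Finite S] [Nontrivial S]
    [TopologicalSpace S] [DiscreteTopology S]
    (p : ℕ) (hp : p.Prime) (hdvd : ¬ p ∣ Nat.card S) :
    Infinite (Quot (elemIso (G := ℕ → S) (p := p) (b := p ^ Nat.card S))) ∧
      ¬ HasUBERG (ℕ → S) := by
  obtain ⟨V, _, _, _, _, hle, hpV, hV, s, v, hsv⟩ :=
    exists_simple_module_nontrivial_action S p hp hdvd
  let e : Carrier (Nat.card V) ≃ V := (Finite.equivFin V).symm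
  let M : ℕ → SimpleGMod (ℕ → S) (Nat.card V) := fun i =>
    SimpleGMod.inflate hV (Pi.evalMonoidHom (fun _ : ℕ => S) i) (continuous_apply i)
      (Function.surjective_eval i) Finite.one_lt_card e
  have hM : ∀ i g x, (M i).smulOp g x = e.symm (g i • e x) := fun _ _ _ => rfl
  have hker : Function.Injective fun i => (M i).kernel := by
    intro i j hij
    by_contra hne
    have hi : Pi.mulSingle j s ∈ (M i).kernel := fun x => by
      rw [hM, Pi.mulSingle_eq_of_ne hne, one_smul, e.symm_apply_apply]
    have hj : Pi.mulSingle j s ∈ (M j).kernel := (show (M i).kernel = (M j).kernel from hij) ▸ hi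
    have := hj (e.symm v)
    rw [hM, Pi.mulSingle_eq_same, e.apply_symm_apply] at this
    exact hsv (e.symm.injective this)
  constructor
  · let X : ℕ → ElemPMod (ℕ → S) p (p ^ Nat.card S) := fun i =>
      ⟨⟨Nat.card V, M i⟩, hle, fun x => by
        let : AddCommGroup (Carrier (Nat.card V)) := e.addCommGroup
        exact e.injective ((map_nsmul e.addEquiv p x).trans
          ((hpV _).trans (map_zero e.addEquiv).symm))⟩
    refine Infinite.of_injective (fun i => Quot.mk elemIso (X i)) fun i j hij => hker ?_
    exact congrArg (Quot.lift (fun Y : ElemPMod (ℕ → S) p (p ^ Nat.card S) => Y.1.2.kernel)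
      fun _ _ => elemIso.kernel_eq) hij
  · rintro ⟨c, hc⟩
    have := (hc (Nat.card V)).1
    refine not_injective_infinite_finite (fun i => Quot.mk gmodIso (M i)) fun i j hij => hker ?_
    exact congrArg (Quot.lift SimpleGMod.kernel fun _ _ => gmodIso.kernel_eq) hij
end
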